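/- Let G be a finite group and p a prime. Let D be a normal p-subgroup of G and let μ ∈ Irr(D) be G-invariant. Then there is a bijection from the set of defect zero characters of G/D onto rdz(G | μ). Moreover, if μ is linear, the bijection χ ↦ χ_μ can be chosen so that χ^o = χ_μ^o, i.e. χ (viewed as a character of G with D in its kernel) and χ_μ agree on all p-regular elements of G. -/

import Mathlib

open scoped Classical

noncomputable section

/-- All prime divisors of `n` belong to the set of primes `σ`. -/
def IsPiNumber (σ : Set ℕ) (n : ℕ) : Prop :=
  ∀ q : ℕ, q.Prime → q ∣ n → q ∈ σ

/-- `g` is a `σ`-element: its order is a `σ`-number. -/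
def IsPiElt (σ : Set ℕ) {G : Type} [Group G] (g : G) : Prop :=
  IsPiNumber σ (orderOf g)

/-- The `p`-part of a natural number. -/
def pPart (p n : ℕ) : ℕ := p ^ (n.factorization p)

/-- `χ` is the character of a finite-dimensional complex representation of `G`. -/
def IsCharacter (G : Type) [Group G] (χ : G → ℂ) : Prop :=
  ∃ V : FDRep ℂ G, ∀ g, χ g = V.character g

/-- `χ` is an irreducible (ordinary, complex) character of `G`: a nonzero character
which is not the sum of two nonzero characters. -/
def IsIrrChar (G : Type) [Group G] (χ : G → ℂ) : Prop :=
  IsCharacter G χ ∧ χ ≠ 0 ∧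
    ¬ ∃ χ₁ χ₂ : G → ℂ, IsCharacter G χ₁ ∧ χ₁ ≠ 0 ∧ IsCharacter G χ₂ ∧ χ₂ ≠ 0 ∧ χ = χ₁ + χ₂

/-- Restriction of a class function on `G` to a subgroup `H`. -/
def resChar {G : Type} [Group G] (H : Subgroup G) (χ : G → ℂ) : ↥H → ℂ :=
  fun h => χ (h : G)

/-- Restriction of a class function between nested subgroups. -/
def resCharLe {G : Type} [Group G] {K H : Subgroup G} (hKH : K ≤ H) (χ : ↥H → ℂ) : ↥K → ℂ :=
  fun k => χ ⟨(k : G), hKH k.2⟩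

/-- The induced class function from a subgroup `H` of `G`, given by the usual
induction formula. -/
def indChar {G : Type} [Group G] [Fintype G] (H : Subgroup G) (ψ : ↥H → ℂ) : G → ℂ :=
  fun g => (Nat.card ↥H : ℂ)⁻¹ *
    ∑ x : G, if h : x * g * x⁻¹ ∈ H then ψ ⟨x * g * x⁻¹, h⟩ else 0

/-- Induction of a class function between nested subgroups. -/
def indCharLe {G : Type} [Group G] [Fintype G] {K H : Subgroup G} (_ : K ≤ H)
    (ψ : ↥K → ℂ) : ↥H → ℂ :=
  fun x => (Nat.card ↥K : ℂ)⁻¹ *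
    ∑ y : ↥H, if h : (y : G) * (x : G) * (y : G)⁻¹ ∈ K then ψ ⟨(y : G) * (x : G) * (y : G)⁻¹, h⟩ else 0

/-- `θ` is an irreducible constituent of the class function `χ`. -/
def IsConstituent {G : Type} [Group G] (θ χ : G → ℂ) : Prop :=
  IsIrrChar G θ ∧ ∃ ξ : G → ℂ, (ξ = 0 ∨ IsCharacter G ξ) ∧ χ = θ + ξ

/-- The restriction `χ^o` of a class function to the `σ`-elements of `G`
(extended by zero elsewhere). -/
def piRestrict (σ : Set ℕ) {G : Type} [Group G] (χ : G → ℂ) : G → ℂ :=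
  fun g => if IsPiElt σ g then χ g else 0

/-- `φ` is a `σ`-partial character of `G`: the restriction to the `σ`-elements of an
ordinary character. -/
def IsPartialChar (σ : Set ℕ) (G : Type) [Group G] (φ : G → ℂ) : Prop :=
  ∃ χ : G → ℂ, IsCharacter G χ ∧ χ ≠ 0 ∧ φ = piRestrict σ χ

/-- `φ ∈ I_σ(G)`: an irreducible `σ`-partial character, i.e. one which is not the
sum of two `σ`-partial characters. -/
def IsIPiChar (σ : Set ℕ) (G : Type) [Group G] (φ : G → ℂ) : Prop :=
  IsPartialChar σ G φ ∧
    ¬ ∃ φ₁ φ₂ : G → ℂ, IsPartialChar σ G φ₁ ∧ IsPartialChar σ G φ₂ ∧ φ = φ₁ + φ₂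

/-- `φ ∈ IBr(G)` (at the prime `p`): irreducible Brauer characters are the irreducible
`p'`-partial characters, where the `p`-regular elements are the `{p}ᶜ`-elements. -/
def IsIBrChar (p : ℕ) (G : Type) [Group G] (φ : G → ℂ) : Prop :=
  IsIPiChar ({p}ᶜ) G φ

/-- The restriction `χ^o` of `χ` to the `p`-regular elements of `G`. -/
def brRestrict (p : ℕ) {G : Type} [Group G] (χ : G → ℂ) : G → ℂ :=
  piRestrict ({p}ᶜ) χ

/-- `χ` is a lift of the `σ`-partial character `φ`. -/
def IsLiftOfPi (σ : Set ℕ) (G : Type) [Group G] (χ φ : G → ℂ) : Prop :=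
  IsIrrChar G χ ∧ piRestrict σ χ = φ

/-- `χ` is a lift: `χ` is irreducible and `χ^o` is an irreducible `σ`-partial character. -/
def IsLiftPi (σ : Set ℕ) (G : Type) [Group G] (χ : G → ℂ) : Prop :=
  IsIrrChar G χ ∧ IsIPiChar σ G (piRestrict σ χ)

/-- `H` is a subnormal subgroup of `G`. -/
def IsSubnormalSubgroup {G : Type} [Group G] (H : Subgroup G) : Prop :=
  ∃ (n : ℕ) (c : Fin (n + 1) → Subgroup G),
    c 0 = H ∧ c (Fin.last n) = ⊤ ∧
    ∀ i : Fin n, c i.castSucc ≤ c i.succ ∧ ((c i.castSucc).subgroupOf (c i.succ)).Normal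

/-- The determinantal order `o(det θ)` of `θ` is a `σ`-number. -/
def HasPiDetOrder (σ : Set ℕ) (G : Type) [Group G] (θ : G → ℂ) : Prop :=
  ∃ V : FDRep ℂ G, (∀ g, θ g = V.character g) ∧
    IsPiNumber σ (orderOf (fun g : G => LinearMap.det (V.ρ g)))

/-- `χ` is a `σ`-special character of `G`: `χ` is irreducible, `χ(1)` is a `σ`-number,
and for every subnormal subgroup `M` of `G`, every irreducible constituent of `χ_M`
has determinantal order a `σ`-number. -/
def IsPiSpecial (σ : Set ℕ) (G : Type) [Group G] (χ : G → ℂ) : Prop :=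
  IsIrrChar G χ ∧ (∃ n : ℕ, χ 1 = (n : ℂ) ∧ IsPiNumber σ n) ∧
    ∀ M : Subgroup G, IsSubnormalSubgroup M →
      ∀ θ : ↥M → ℂ, IsConstituent θ (resChar M χ) → HasPiDetOrder σ ↥M θ

/-- `χ` is `σ`-factored: `χ = αβ` with `α` `σ`-special and `β` `σ'`-special. -/
def IsPiFactored (σ : Set ℕ) (G : Type) [Group G] (χ : G → ℂ) : Prop :=
  ∃ α β : G → ℂ, IsPiSpecial σ G α ∧ IsPiSpecial σᶜ G β ∧ χ = α * β

/-- `G` is `σ`-separable: it has a subnormal series each of whose factors is a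
`σ`-group or a `σ'`-group (equivalently, every composition factor is a `σ`-group or a
`σ'`-group). -/
def IsPiSeparable (σ : Set ℕ) (G : Type) [Group G] : Prop :=
  ∃ (n : ℕ) (c : Fin (n + 1) → Subgroup G),
    c 0 = ⊥ ∧ c (Fin.last n) = ⊤ ∧
    ∀ i : Fin n, c i.castSucc ≤ c i.succ ∧ ((c i.castSucc).subgroupOf (c i.succ)).Normal ∧
      (IsPiNumber σ (Nat.card (↥(c i.succ) ⧸ (c i.castSucc).subgroupOf (c i.succ))) ∨
        IsPiNumber σᶜ (Nat.card (↥(c i.succ) ⧸ (c i.castSucc).subgroupOf (c i.succ))))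

/-- `G` is `p`-solvable: every composition factor is a `p`-group or a `p'`-group. -/
def IsPSolvable (p : ℕ) (G : Type) [Group G] : Prop :=
  IsPiSeparable {p} G

/-- The character `δ` of the subgroup `Q` is invariant under (conjugation by the
elements of) the subgroup `S`. -/
def InvariantUnder {G : Type} [Group G] (Q : Subgroup G) (δ : ↥Q → ℂ) (S : Subgroup G) : Prop :=
  ∀ g ∈ S, ∀ x : ↥Q, ∀ h : g * (x : G) * g⁻¹ ∈ Q, δ ⟨g * (x : G) * g⁻¹, h⟩ = δ x

/-- `(Q, δ)` is a vertex pair for `χ ∈ Irr(G)` (at the prime `p`): `Q` is a `p`-subgroup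
of `G`, `δ ∈ Irr(Q)`, and there are a subgroup `U ≤ G` and an irreducible character
`ψ = αβ` of `U` with `α` `p'`-special and `β` `p`-special, such that `ψ^G = χ`, `Q` is a
Sylow `p`-subgroup of `U`, and `β_Q = δ`. -/
def IsVertexPair (p : ℕ) {G : Type} [Group G] [Fintype G] (χ : G → ℂ)
    (Q : Subgroup G) (δ : ↥Q → ℂ) : Prop :=
  IsPGroup p ↥Q ∧ IsIrrChar ↥Q δ ∧
    ∃ (U : Subgroup G) (hQU : Q ≤ U) (α β : ↥U → ℂ),
      IsPiSpecial ({p}ᶜ) ↥U α ∧ IsPiSpecial {p} ↥U β ∧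
      IsIrrChar ↥U (α * β) ∧ indChar U (α * β) = χ ∧
      ¬ p ∣ (Q.subgroupOf U).index ∧
      ∀ x : ↥Q, δ x = β ⟨(x : G), hQU x.2⟩

/-- `(Q, δ)` is a generalized `σ`-vertex for `χ ∈ Irr(G)`: there are `U ≤ G` and an
irreducible `ψ = αβ ∈ Irr(U)` with `α` `σ`-special and `β` `σ'`-special such that
`ψ^G = χ`, `Q` is a Hall `σ'`-subgroup of `U` and `δ = β_Q`. -/
def IsGenPiVertex (σ : Set ℕ) {G : Type} [Group G] [Fintype G] (χ : G → ℂ)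
    (Q : Subgroup G) (δ : ↥Q → ℂ) : Prop :=
  ∃ (U : Subgroup G) (hQU : Q ≤ U) (α β : ↥U → ℂ),
    IsPiSpecial σ ↥U α ∧ IsPiSpecial σᶜ ↥U β ∧
    IsIrrChar ↥U (α * β) ∧ indChar U (α * β) = χ ∧
    IsPiNumber σᶜ (Nat.card ↥Q) ∧ IsPiNumber σ ((Q.subgroupOf U).index) ∧
    ∀ x : ↥Q, δ x = β ⟨(x : G), hQU x.2⟩

/-- The pair `(Q₂, δ₂)` is the conjugate of the pair `(Q₁, δ₁)` by the element `g`. -/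
def IsConjPair {G : Type} [Group G] (g : G)
    (Q₁ : Subgroup G) (δ₁ : ↥Q₁ → ℂ) (Q₂ : Subgroup G) (δ₂ : ↥Q₂ → ℂ) : Prop :=
  Q₂ = Subgroup.map (MulAut.conj g).toMonoidHom Q₁ ∧
    ∀ x : ↥Q₁, ∀ h : g * (x : G) * g⁻¹ ∈ Q₂, δ₂ ⟨g * (x : G) * g⁻¹, h⟩ = δ₁ x

/-- `Q` is a vertex (subgroup) of the irreducible `σ`-partial character `φ` of `G`:
`Q` is a Hall `σ'`-subgroup of a subgroup `U ≤ G` possessing an irreducible `σ`-partial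
character `κ` of `σ`-degree with `κ^G = φ`. -/
def IsVertexSubgroup (σ : Set ℕ) {G : Type} [Group G] [Fintype G] (φ : G → ℂ)
    (Q : Subgroup G) : Prop :=
  ∃ (U : Subgroup G) (κ : ↥U → ℂ), Q ≤ U ∧
    IsPiNumber σᶜ (Nat.card ↥Q) ∧ IsPiNumber σ ((Q.subgroupOf U).index) ∧
    IsIPiChar σ ↥U κ ∧ (∃ n : ℕ, κ 1 = (n : ℂ) ∧ IsPiNumber σ n) ∧
    indChar U κ = φ

/-- `θ ∈ I_σ(M)` is an irreducible constituent of the restriction `φ_M`. -/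
def IsIPiConstituent (σ : Set ℕ) {G : Type} [Group G] (M : Subgroup G)
    (θ : ↥M → ℂ) (φ : G → ℂ) : Prop :=
  IsIPiChar σ ↥M θ ∧ ∃ ξ : ↥M → ℂ, (ξ = 0 ∨ IsPartialChar σ ↥M ξ) ∧ resChar M φ = θ + ξ

open Representation in
theorem isCharacter_iff_representation {G : Type} [Group G] {χ : G → ℂ} :
    IsCharacter G χ ↔ ∃ (V : Type) (_ : AddCommGroup V) (_ : Module ℂ V)
      (_ : FiniteDimensional ℂ V) (ρ : Representation ℂ G V), χ = ρ.character := by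
  constructor
  · rintro ⟨V, hV⟩
    exact ⟨V, inferInstance, inferInstance, inferInstance, V.ρ, funext hV⟩
  · rintro ⟨V, _, _, _, ρ, rfl⟩
    exact ⟨FDRep.of ρ, fun g => rfl⟩

theorem trace_pow_eq_sum_roots_of_unity {V : Type} [AddCommGroup V] [Module ℂ V]
    [FiniteDimensional ℂ V] (A : Module.End ℂ V) {N : ℕ} (hN : 0 < N) (hA : A ^ N = 1) :
    ∃ (s : Finset ℂ) (m : ℂ → ℕ), (∀ z ∈ s, z ^ N = 1) ∧
      ∀ k : ℕ, LinearMap.trace ℂ V (A ^ k) = ∑ z ∈ s, m z * z ^ k := by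
  have hss : A.IsSemisimple := by
    refine Module.End.isSemisimple_of_squarefree_aeval_eq_zero
      (p := Polynomial.X ^ N - 1) ?_ (by simp [hA])
    have : (Polynomial.X ^ N - 1 : Polynomial ℂ).Separable :=
      (Polynomial.X_pow_sub_one_separable_iff).2 (by exact_mod_cast hN.ne')
    exact this.squarefree
  have htop : (⨆ z : ℂ, A.eigenspace z) = ⊤ :=
    (hss.iSup_maxGenEigenspace_eq_top_iff).1 (Module.End.iSup_maxGenEigenspace_eq_top A)
  have hint := DirectSum.isInternal_submodule_of_iSupIndep_of_iSup_eq_top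
    A.eigenspaces_iSupIndep htop
  have hfin : {z | A.eigenspace z ≠ ⊥}.Finite :=
    WellFoundedGT.finite_ne_bot_of_iSupIndep A.eigenspaces_iSupIndep
  have hpow : ∀ (k : ℕ) (z : ℂ), ∀ v ∈ A.eigenspace z, (A ^ k) v = z ^ k • v := by
    intro k z v hv
    induction k with
    | zero => simp
    | succ k ih =>
      rw [pow_succ', Module.End.mul_apply, ih, map_smul, Module.End.mem_eigenspace_iff.1 hv,
        smul_smul, pow_succ]
  refine ⟨hfin.toFinset, fun z => Module.finrank ℂ (A.eigenspace z), ?_, ?_⟩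
  · intro z hz
    rw [Set.Finite.mem_toFinset, Set.mem_ofPred_eq, Submodule.ne_bot_iff] at hz
    obtain ⟨v, hv, hv0⟩ := hz
    have h := hpow N z v hv
    rw [hA, Module.End.one_apply] at h
    have h2 : (z ^ N - 1) • v = 0 := by rw [sub_smul, ← h, one_smul, sub_self]
    rcases smul_eq_zero.1 h2 with h3 | h3
    · exact sub_eq_zero.1 h3
    · exact absurd h3 hv0
  · intro k
    have hmaps : ∀ z, Set.MapsTo (A ^ k) (A.eigenspace z) (A.eigenspace z) := by
      intro z v hv
      have := hpow k z v hv
      simp only [SetLike.mem_coe] at hv ⊢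
      rw [this]
      exact Submodule.smul_mem _ _ hv
    rw [LinearMap.trace_eq_sum_trace_restrict' hint hfin hmaps]
    refine Finset.sum_congr rfl fun z _ => ?_
    have : (A ^ k).restrict (hmaps z) = z ^ k • LinearMap.id := by
      ext v
      exact hpow k z v.1 v.2
    rw [this, map_smul, LinearMap.trace_id, smul_eq_mul, mul_comm]

section CharacterValues

variable {G : Type} [Group G] {χ : G → ℂ}

theorem IsCharacter.exists_sum_pow (hχ : IsCharacter G χ) (x : G) {N : ℕ} (hN : 0 < N)
    (hx : x ^ N = 1) :
    ∃ (s : Finset ℂ) (m : ℂ → ℕ), (∀ z ∈ s, z ^ N = 1) ∧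
      ∀ k : ℕ, χ (x ^ k) = ∑ z ∈ s, m z * z ^ k := by
  obtain ⟨V, _, _, _, ρ, rfl⟩ := isCharacter_iff_representation.1 hχ
  obtain ⟨s, m, h1, h2⟩ := trace_pow_eq_sum_roots_of_unity (ρ x) hN
    (by rw [← map_pow, hx, map_one])
  refine ⟨s, m, h1, fun k => ?_⟩
  rw [← h2 k, Representation.character, map_pow]

theorem IsCharacter.map_inv [Finite G] (hχ : IsCharacter G χ) (x : G) :
    χ x⁻¹ = (starRingEnd ℂ) (χ x) := by
  have hN : 0 < orderOf x := orderOf_pos x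
  obtain ⟨s, m, h1, h2⟩ := hχ.exists_sum_pow x hN (pow_orderOf_eq_one x)
  have h3 := h2 1
  have h4 := h2 (orderOf x - 1)
  have h5 : x ^ (orderOf x - 1) = x⁻¹ := by
    rw [eq_inv_iff_mul_eq_one, ← pow_succ, Nat.sub_add_cancel hN, pow_orderOf_eq_one]
  rw [h5] at h4
  rw [pow_one] at h3
  rw [h4, h3, map_sum]
  refine Finset.sum_congr rfl fun z hz => ?_
  have hz1 := h1 z hz
  have hn : ‖z‖ = 1 := Complex.norm_eq_one_of_pow_eq_one hz1 hN.ne'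
  rw [map_mul, pow_one, Complex.conj_natCast]
  congr 1
  rw [← Complex.inv_eq_conj hn]
  exact eq_inv_of_mul_eq_one_left (by rw [← pow_succ, Nat.sub_add_cancel hN, hz1])

theorem IsCharacter.isIntegral [Finite G] (hχ : IsCharacter G χ) (x : G) : IsIntegral ℤ (χ x) := by
  obtain ⟨s, m, h1, h2⟩ := hχ.exists_sum_pow x (orderOf_pos x) (pow_orderOf_eq_one x)
  have h3 := h2 1
  rw [pow_one] at h3
  rw [h3]
  refine IsIntegral.sum _ fun z hz => ?_
  refine IsIntegral.mul (by simpa using isIntegral_algebraMap (R := ℤ) (A := ℂ) (x := (m z : ℤ))) ?_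
  rw [pow_one]
  exact IsIntegral.of_pow (orderOf_pos x) (by rw [h1 z hz]; exact isIntegral_one)

theorem IsCharacter.map_conj (hχ : IsCharacter G χ) (x g : G) : χ (g * x * g⁻¹) = χ x := by
  obtain ⟨V, _, _, _, ρ, rfl⟩ := isCharacter_iff_representation.1 hχ
  exact ρ.char_conj x g

theorem IsCharacter.exists_degree (hχ : IsCharacter G χ) : ∃ n : ℕ, χ 1 = n := by
  obtain ⟨V, _, _, _, ρ, rfl⟩ := isCharacter_iff_representation.1 hχ
  exact ⟨_, ρ.char_one⟩

theorem IsCharacter.eq_zero_of_degree_eq_zero (hχ : IsCharacter G χ) (h : χ 1 = 0) : χ = 0 := by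
  obtain ⟨V, _, _, _, ρ, rfl⟩ := isCharacter_iff_representation.1 hχ
  rw [ρ.char_one, Nat.cast_eq_zero] at h
  have : Subsingleton V := Module.finrank_zero_iff.1 h
  ext g
  rw [Representation.character, Subsingleton.elim (ρ g) 0, map_zero, Pi.zero_apply]

theorem IsCharacter.degree_ne_zero (hχ : IsCharacter G χ) (h : χ ≠ 0) : χ 1 ≠ 0 :=
  fun h' => h (hχ.eq_zero_of_degree_eq_zero h')

theorem IsCharacter.mul {ψ : G → ℂ} (hχ : IsCharacter G χ) (hψ : IsCharacter G ψ) :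
    IsCharacter G (χ * ψ) := by
  obtain ⟨V, _, _, _, ρ, rfl⟩ := isCharacter_iff_representation.1 hχ
  obtain ⟨W, _, _, _, σ, rfl⟩ := isCharacter_iff_representation.1 hψ
  exact isCharacter_iff_representation.2
    ⟨_, inferInstance, inferInstance, inferInstance, ρ.tprod σ, (ρ.char_tensor σ).symm⟩

theorem IsCharacter.conj [Finite G] (hχ : IsCharacter G χ) :
    IsCharacter G (fun x => (starRingEnd ℂ) (χ x)) := by
  have h := hχ
  obtain ⟨V, _, _, _, ρ, rfl⟩ := isCharacter_iff_representation.1 hχ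
  refine isCharacter_iff_representation.2
    ⟨_, inferInstance, inferInstance, inferInstance, ρ.dual, ?_⟩
  ext g
  rw [ρ.char_dual, h.map_inv]

theorem IsCharacter.comp {H : Type} [Group H] (hχ : IsCharacter G χ) (φ : H →* G) :
    IsCharacter H (fun x => χ (φ x)) := by
  obtain ⟨V, _, _, _, ρ, rfl⟩ := isCharacter_iff_representation.1 hχ
  exact isCharacter_iff_representation.2
    ⟨V, inferInstance, inferInstance, inferInstance, ρ.comp φ, rfl⟩

end CharacterValues

/-- The normalised hermitian inner product of two functions on a finite group. -/
def classInner {G : Type} [Group G] [Fintype G] (f g : G → ℂ) : ℂ :=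
  (Nat.card G : ℂ)⁻¹ * ∑ x, f x * (starRingEnd ℂ) (g x)

section Inner

variable {G : Type} [Group G] [Fintype G]

theorem card_ne_zero_complex : (Nat.card G : ℂ) ≠ 0 :=
  Nat.cast_ne_zero.2 Nat.card_pos.ne'

instance invertibleCardComplex : Invertible (Nat.card G : ℂ) :=
  invertibleOfNonzero card_ne_zero_complex

instance neZeroCardComplex : NeZero (Nat.card G : ℂ) := ⟨card_ne_zero_complex⟩

theorem classInner_add_left (f g h : G → ℂ) :
    classInner (f + g) h = classInner f h + classInner g h := by
  simp [classInner, add_mul, Finset.sum_add_distrib, mul_add]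

theorem classInner_sub_left (f g h : G → ℂ) :
    classInner (f - g) h = classInner f h - classInner g h := by
  simp [classInner, sub_mul, Finset.sum_sub_distrib, mul_sub]

theorem classInner_smul_left (c : ℂ) (f h : G → ℂ) :
    classInner (c • f) h = c * classInner f h := by
  simp only [classInner, Pi.smul_apply, smul_eq_mul, mul_assoc, ← Finset.mul_sum]
  ring

theorem classInner_conj (f h : G → ℂ) :
    (starRingEnd ℂ) (classInner f h) = classInner h f := by
  simp [classInner, map_sum, mul_comm]

theorem classInner_add_right (f g h : G → ℂ) :
    classInner f (g + h) = classInner f g + classInner f h := by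
  simp [classInner, mul_add, Finset.sum_add_distrib]

theorem classInner_self (f : G → ℂ) :
    classInner f f = (((Nat.card G : ℝ)⁻¹ * ∑ x, ‖f x‖ ^ 2 : ℝ) : ℂ) := by
  simp only [classInner, Complex.mul_conj']
  push_cast
  rfl

theorem classInner_self_eq_zero {f : G → ℂ} : classInner f f = 0 ↔ f = 0 := by
  rw [classInner_self, Complex.ofReal_eq_zero, mul_eq_zero]
  have h : ((Nat.card G : ℝ)⁻¹ ≠ 0) := inv_ne_zero (Nat.cast_ne_zero.2 Nat.card_pos.ne')
  constructor
  · rintro (h' | h')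
    · exact absurd h' h
    · rw [Finset.sum_eq_zero_iff_of_nonneg (fun _ _ => by positivity)] at h'
      ext x
      simpa using h' x (Finset.mem_univ x)
  · rintro rfl
    right
    simp

theorem classInner_eq_finrank {V W : Type} [AddCommGroup V] [Module ℂ V] [FiniteDimensional ℂ V]
    [AddCommGroup W] [Module ℂ W] [FiniteDimensional ℂ W] (ρ : Representation ℂ G V)
    (σ : Representation ℂ G W) :
    classInner σ.character ρ.character = Module.finrank ℂ (ρ.IntertwiningMap σ) := by
  rw [← Representation.card_inv_mul_sum_char_mul_char_eq_finrank ρ σ, classInner]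
  have h : IsCharacter G ρ.character := isCharacter_iff_representation.2
    ⟨V, inferInstance, inferInstance, inferInstance, ρ, rfl⟩
  simp only [h.map_inv]

theorem IsCharacter.exists_classInner_eq {χ ψ : G → ℂ} (hχ : IsCharacter G χ)
    (hψ : IsCharacter G ψ) : ∃ n : ℕ, classInner χ ψ = n := by
  obtain ⟨V, _, _, _, ρ, rfl⟩ := isCharacter_iff_representation.1 hχ
  obtain ⟨W, _, _, _, σ, rfl⟩ := isCharacter_iff_representation.1 hψ
  exact ⟨_, classInner_eq_finrank σ ρ⟩

theorem IsCharacter.isIrrChar_of_classInner {χ : G → ℂ} (hχ : IsCharacter G χ)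
    (h : classInner χ χ = 1) : IsIrrChar G χ := by
  refine ⟨hχ, ?_, ?_⟩
  · rintro rfl
    rw [classInner_self_eq_zero.2 rfl] at h
    exact zero_ne_one h
  · rintro ⟨a, b, ha, ha0, hb, hb0, rfl⟩
    rw [classInner_add_left, classInner_add_right, classInner_add_right] at h
    obtain ⟨n1, h1⟩ := ha.exists_classInner_eq ha
    obtain ⟨n2, h2⟩ := ha.exists_classInner_eq hb
    obtain ⟨n3, h3⟩ := hb.exists_classInner_eq ha
    obtain ⟨n4, h4⟩ := hb.exists_classInner_eq hb
    have h1' : n1 ≠ 0 := by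
      rintro rfl
      exact ha0 (classInner_self_eq_zero.1 (by simpa using h1))
    have h4' : n4 ≠ 0 := by
      rintro rfl
      exact hb0 (classInner_self_eq_zero.1 (by simpa using h4))
    rw [h1, h2, h3, h4] at h
    have : n1 + n2 + (n3 + n4) = 1 := by exact_mod_cast h
    omega

omit [Fintype G] in
theorem Subrepresentation.character_add_of_isCompl {V : Type} [AddCommGroup V] [Module ℂ V]
    [FiniteDimensional ℂ V] {ρ : Representation ℂ G V} {a b : Subrepresentation ρ}
    (hab : IsCompl a.toSubmodule b.toSubmodule) :
    ρ.character = a.toRepresentation.character + b.toRepresentation.character := by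
  ext g
  let e := Submodule.prodEquivOfIsCompl _ _ hab
  have : ρ g = e.conj ((a.toRepresentation g).prodMap (b.toRepresentation g)) := by
    ext v
    obtain ⟨w, rfl⟩ := e.surjective v
    rw [LinearEquiv.conj_apply_apply, e.symm_apply_apply]
    simp [e, Subrepresentation.toRepresentation]
  rw [Representation.character, this, LinearMap.trace_conj', LinearMap.trace_prodMap']
  rfl

theorem Subrepresentation.exists_compl {V : Type} [AddCommGroup V] [Module ℂ V]
    [FiniteDimensional ℂ V] {ρ : Representation ℂ G V} (a : Subrepresentation ρ) :
    ∃ b : Subrepresentation ρ, IsCompl a.toSubmodule b.toSubmodule := by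
  obtain ⟨b, hb⟩ := exists_isCompl a
  refine ⟨b, ?_, ?_⟩
  · rw [disjoint_iff]
    exact congrArg Subrepresentation.toSubmodule (disjoint_iff.1 hb.1)
  · rw [codisjoint_iff]
    exact congrArg Subrepresentation.toSubmodule (codisjoint_iff.1 hb.2)

omit [Fintype G] in
theorem isCharacter_character {V : Type} [AddCommGroup V] [Module ℂ V]
    [FiniteDimensional ℂ V] (ρ : Representation ℂ G V) : IsCharacter G ρ.character :=
  isCharacter_iff_representation.2 ⟨V, inferInstance, inferInstance, inferInstance, ρ, rfl⟩

omit [Fintype G] in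
theorem character_ne_zero {V : Type} [AddCommGroup V] [Module ℂ V]
    [FiniteDimensional ℂ V] [Nontrivial V] (ρ : Representation ℂ G V) : ρ.character ≠ 0 := by
  intro h
  have := congrFun h 1
  rw [ρ.char_one, Pi.zero_apply, Nat.cast_eq_zero] at this
  exact Module.finrank_pos.ne' this

theorem IsIrrChar.exists_isIrreducible {χ : G → ℂ} (hχ : IsIrrChar G χ) :
    ∃ (V : Type) (_ : AddCommGroup V) (_ : Module ℂ V)
      (_ : FiniteDimensional ℂ V) (ρ : Representation ℂ G V), ρ.IsIrreducible ∧
        χ = ρ.character := by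
  obtain ⟨h1, h2, h3⟩ := hχ
  obtain ⟨V, _, _, _, ρ, rfl⟩ := isCharacter_iff_representation.1 h1
  refine ⟨V, inferInstance, inferInstance, inferInstance, ρ, ?_, rfl⟩
  have : Nontrivial V := by
    by_contra h
    rw [not_nontrivial_iff_subsingleton] at h
    refine h2 (h1.eq_zero_of_degree_eq_zero ?_)
    rw [ρ.char_one, Module.finrank_zero_of_subsingleton, Nat.cast_zero]
  have hnt : Nontrivial (Subrepresentation ρ) :=
    ⟨⊥, ⊤, fun h => (bot_ne_top (α := Submodule ℂ V)) (congrArg Subrepresentation.toSubmodule h)⟩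
  refine ⟨fun a => ?_⟩
  by_contra! h
  obtain ⟨b, hab⟩ := a.exists_compl
  have ha : a.toSubmodule ≠ ⊥ := fun h' => h.1 (Subrepresentation.toSubmodule_injective h')
  have hb : b.toSubmodule ≠ ⊥ := by
    intro h'
    rw [h'] at hab
    have h'' : a.toSubmodule = ⊤ := by simpa using hab.codisjoint.eq_top
    exact h.2 (Subrepresentation.toSubmodule_injective h'')
  have := Submodule.nontrivial_iff_ne_bot.2 ha
  have := Submodule.nontrivial_iff_ne_bot.2 hb
  exact h3 ⟨_, _, isCharacter_character a.toRepresentation, character_ne_zero _,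
    isCharacter_character b.toRepresentation, character_ne_zero _,
    Subrepresentation.character_add_of_isCompl hab⟩

theorem Representation.IsIrreducible.isIrrChar {V : Type} [AddCommGroup V] [Module ℂ V]
    [FiniteDimensional ℂ V] (ρ : Representation ℂ G V) (h : ρ.IsIrreducible) :
    IsIrrChar G ρ.character := by
  refine (isCharacter_character ρ).isIrrChar_of_classInner ?_
  rw [classInner_eq_finrank, Representation.IsIrreducible.finrank_intertwiningMap_self,
    Nat.cast_one]

theorem IsIrrChar.classInner_self {χ : G → ℂ} (hχ : IsIrrChar G χ) : classInner χ χ = 1 := by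
  obtain ⟨V, _, _, _, ρ, h, rfl⟩ := hχ.exists_isIrreducible
  rw [classInner_eq_finrank, Representation.IsIrreducible.finrank_intertwiningMap_self,
    Nat.cast_one]

theorem IsIrrChar.eq_of_classInner_ne_zero {χ ψ : G → ℂ} (hχ : IsIrrChar G χ)
    (hψ : IsIrrChar G ψ) (h0 : classInner χ ψ ≠ 0) : χ = ψ := by
  obtain ⟨V, _, _, _, ρ, h, rfl⟩ := hχ.exists_isIrreducible
  obtain ⟨W, _, _, _, σ, h', rfl⟩ := hψ.exists_isIrreducible
  rw [classInner_eq_finrank, Nat.cast_ne_zero, ← pos_iff_ne_zero, Module.finrank_pos_iff] at h0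
  obtain ⟨f, hf⟩ := exists_ne (0 : σ.IntertwiningMap ρ)
  rcases Representation.IsIrreducible.bijective_or_eq_zero f with hb | hb
  · exact (Representation.char_iso (Representation.IntertwiningMap.ofBijective f hb)).symm
  · exact absurd hb hf

theorem isConstituent_iff {θ χ : G → ℂ} (hθ : IsIrrChar G θ) (hχ : IsCharacter G χ) :
    IsConstituent θ χ ↔ classInner χ θ ≠ 0 := by
  constructor
  · rintro ⟨-, ξ, hξ, rfl⟩ h
    rw [classInner_add_left, hθ.classInner_self] at h
    rcases hξ with rfl | hξ
    · simp [classInner] at h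
    · obtain ⟨n, hn⟩ := hξ.exists_classInner_eq hθ.1
      rw [hn] at h
      norm_cast at h
      omega
  · intro h0
    refine ⟨hθ, ?_⟩
    obtain ⟨V, _, _, _, ρ, h, rfl⟩ := hθ.exists_isIrreducible
    obtain ⟨W, _, _, _, σ, rfl⟩ := isCharacter_iff_representation.1 hχ
    rw [classInner_eq_finrank, Nat.cast_ne_zero, ← pos_iff_ne_zero, Module.finrank_pos_iff] at h0
    obtain ⟨f, hf⟩ := exists_ne (0 : ρ.IntertwiningMap σ)
    have hinj : Function.Injective f :=
      (Representation.IsIrreducible.injective_or_eq_zero f).resolve_right hf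
    let a : Subrepresentation σ := ⟨LinearMap.range f.toLinearMap, by
      rintro g _ ⟨v, rfl⟩
      exact ⟨ρ g v, LinearMap.congr_fun (f.isIntertwining' g) v⟩⟩
    obtain ⟨b, hab⟩ := a.exists_compl
    refine ⟨_, Or.inr (isCharacter_character b.toRepresentation), ?_⟩
    rw [Subrepresentation.character_add_of_isCompl hab]
    congr 1
    ext g
    let e := LinearEquiv.ofInjective f.toLinearMap hinj
    have : a.toRepresentation g = e.conj (ρ g) := by
      refine LinearMap.ext fun v => ?_
      obtain ⟨w, rfl⟩ := e.surjective v
      rw [LinearEquiv.conj_apply_apply, e.symm_apply_apply]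
      exact Subtype.ext (LinearMap.congr_fun (f.isIntertwining' g) w).symm
    rw [Representation.character, this, LinearMap.trace_conj', Representation.character]

omit [Fintype G] in
/-- Schur's lemma: an endomorphism commuting with an irreducible representation is a scalar. -/
theorem Representation.IsIrreducible.exists_smul_one {V : Type} [AddCommGroup V] [Module ℂ V]
    [FiniteDimensional ℂ V] {ρ : Representation ℂ G V} (h : ρ.IsIrreducible)
    (T : Module.End ℂ V) (hT : ∀ g, T * ρ g = ρ g * T) : ∃ c : ℂ, T = c • 1 := by
  obtain ⟨c, hc⟩ := (Representation.IsIrreducible.algebraMap_intertwiningMap_bijective_of_isAlgClosed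
    (ρ := ρ)).2 ⟨T, hT⟩
  refine ⟨c, ?_⟩
  rw [Algebra.algebraMap_eq_smul_one] at hc
  exact (congrArg Representation.IntertwiningMap.toLinearMap hc).symm

theorem Representation.IsIrreducible.finrank_ne_zero {V : Type} [AddCommGroup V] [Module ℂ V]
    [FiniteDimensional ℂ V] {ρ : Representation ℂ G V} (h : ρ.IsIrreducible) :
    (Module.finrank ℂ V : ℂ) ≠ 0 := by
  rw [← ρ.char_one]
  exact (isCharacter_character ρ).degree_ne_zero h.isIrrChar.2.1

theorem sum_smul_inv_eq_zero {f : G → ℂ} (hf : ∀ x g, f (g * x * g⁻¹) = f x)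
    (h0 : ∀ ψ, IsIrrChar G ψ → classInner f ψ = 0) {V : Type} [AddCommGroup V] [Module ℂ V]
    [FiniteDimensional ℂ V] (ρ : Representation ℂ G V) : ∑ x, f x • ρ x⁻¹ = 0 := by
  induction hn : Module.finrank ℂ V using Nat.strong_induction_on generalizing V with
  | _ n ih =>
  subst hn
  by_cases hz : ρ.character = 0
  · have h1 := congrFun hz 1
    rw [ρ.char_one, Pi.zero_apply, Nat.cast_eq_zero] at h1
    have : Subsingleton V := Module.finrank_zero_iff.1 h1
    exact Subsingleton.elim _ _
  by_cases hirr : ρ.IsIrreducible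
  · obtain ⟨c, hc⟩ := hirr.exists_smul_one (∑ x, f x • ρ x⁻¹) (by
      intro g
      rw [Finset.sum_mul, Finset.mul_sum]
      refine Fintype.sum_equiv (MulAut.conj g⁻¹).toEquiv _ _ fun x => ?_
      simp only [MulEquiv.toEquiv_eq_coe, MulEquiv.coe_toEquiv, MulAut.conj_apply, hf]
      rw [smul_mul_assoc, mul_smul_comm, ← map_mul, ← map_mul]
      congr 2
      group)
    have ht := congrArg (LinearMap.trace ℂ V) hc
    have h2 : ∑ x, f x * (starRingEnd ℂ) (ρ.character x) = 0 := by
      have := h0 _ hirr.isIrrChar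
      rw [classInner, mul_eq_zero] at this
      exact this.resolve_left (inv_ne_zero card_ne_zero_complex)
    rw [map_sum, map_smul, LinearMap.trace_one, smul_eq_mul] at ht
    have h3 : ∑ x, LinearMap.trace ℂ V (f x • ρ x⁻¹) = 0 := by
      rw [← h2]
      refine Finset.sum_congr rfl fun x _ => ?_
      rw [map_smul, smul_eq_mul, ← (isCharacter_character ρ).map_inv]
      rfl
    rw [h3] at ht
    have := (mul_eq_zero.1 ht.symm).resolve_right hirr.finrank_ne_zero
    rw [hc, this, zero_smul]
  · have hred : ∃ a : Subrepresentation ρ, a.toSubmodule ≠ ⊥ ∧ a.toSubmodule ≠ ⊤ := by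
      by_contra! h
      refine hirr ?_
      have hnt : Nontrivial V := by
        by_contra h
        rw [not_nontrivial_iff_subsingleton] at h
        exact hz ((isCharacter_character ρ).eq_zero_of_degree_eq_zero
          (by rw [ρ.char_one, Module.finrank_zero_of_subsingleton, Nat.cast_zero]))
      have : Nontrivial (Subrepresentation ρ) :=
        ⟨⊥, ⊤, fun h => (bot_ne_top (α := Submodule ℂ V))
          (congrArg Subrepresentation.toSubmodule h)⟩
      refine ⟨fun a => ?_⟩
      by_cases ha : a.toSubmodule = ⊥
      · exact Or.inl (Subrepresentation.toSubmodule_injective ha)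
      · exact Or.inr (Subrepresentation.toSubmodule_injective (h a ha))
    obtain ⟨a, ha, ha'⟩ := hred
    obtain ⟨b, hab⟩ := a.exists_compl
    have hb' : b.toSubmodule ≠ ⊤ := by
      intro h'
      rw [h'] at hab
      exact ha (by simpa using hab.disjoint.eq_bot)
    have key : ∀ s : Subrepresentation ρ, s.toSubmodule ≠ ⊤ → ∀ v ∈ s.toSubmodule,
        (∑ x, f x • ρ x⁻¹) v = 0 := by
      intro s hs v hv
      have h1 := LinearMap.congr_fun (ih _ (Submodule.finrank_lt hs) s.toRepresentation rfl)
        ⟨v, hv⟩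
      have h2 := congrArg Subtype.val h1
      rw [LinearMap.sum_apply] at h2 ⊢
      rw [← Submodule.subtype_apply, map_sum] at h2
      exact h2
    ext v
    obtain ⟨y, hy, z, hz', rfl⟩ := Submodule.mem_sup.1
      (hab.codisjoint.eq_top ▸ Submodule.mem_top : v ∈ a.toSubmodule ⊔ b.toSubmodule)
    rw [map_add, key a ha' y hy, key b hb' z hz', LinearMap.zero_apply, add_zero]

/-- A nonzero class function is not orthogonal to all irreducible characters. -/
theorem exists_isIrrChar_classInner_ne_zero {f : G → ℂ} (hf : ∀ x g, f (g * x * g⁻¹) = f x)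
    (hf0 : f ≠ 0) : ∃ ψ, IsIrrChar G ψ ∧ classInner f ψ ≠ 0 := by
  by_contra! h
  refine hf0 ?_
  let ρ : Representation ℂ G (G → ℂ) :=
    { toFun := fun g => LinearMap.funLeft ℂ ℂ (fun x => g⁻¹ * x)
      map_one' := by ext; simp [LinearMap.funLeft_apply]
      map_mul' := fun a b => by
        ext
        simp [LinearMap.funLeft_apply, mul_assoc] }
  have h1 := LinearMap.congr_fun (sum_smul_inv_eq_zero hf h ρ) (Pi.single (1 : G) (1 : ℂ))
  ext y
  have h2 := congrFun h1 y⁻¹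
  have h3 : ∀ x, ρ x⁻¹ (Pi.single (1 : G) (1 : ℂ)) y⁻¹ = if x = y then 1 else 0 := by
    intro x
    change (Pi.single (1 : G) (1 : ℂ) : G → ℂ) (x⁻¹⁻¹ * y⁻¹) = _
    rw [Pi.single_apply, inv_inv, mul_inv_eq_one]
  rw [LinearMap.sum_apply, Finset.sum_apply] at h2
  simpa [h3] using h2

end Inner

/-- `z` is an algebraic integer multiple of the natural number `d`. -/
def IsIntegralMultiple (d : ℕ) (z : ℂ) : Prop := ∃ w : ℂ, IsIntegral ℤ w ∧ z = d * w

theorem isIntegral_natCast_complex (n : ℕ) : IsIntegral ℤ (n : ℂ) := by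
  simpa using isIntegral_algebraMap (R := ℤ) (A := ℂ) (x := (n : ℤ))

theorem IsIntegralMultiple.zero (d : ℕ) : IsIntegralMultiple d 0 :=
  ⟨0, isIntegral_zero, by simp⟩

theorem IsIntegralMultiple.add {d : ℕ} {z w : ℂ} (hz : IsIntegralMultiple d z)
    (hw : IsIntegralMultiple d w) : IsIntegralMultiple d (z + w) := by
  obtain ⟨a, ha, rfl⟩ := hz
  obtain ⟨b, hb, rfl⟩ := hw
  exact ⟨a + b, ha.add hb, by ring⟩

theorem IsIntegralMultiple.mul_left {d : ℕ} {z a : ℂ} (ha : IsIntegral ℤ a)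
    (hz : IsIntegralMultiple d z) : IsIntegralMultiple d (a * z) := by
  obtain ⟨b, hb, rfl⟩ := hz
  exact ⟨a * b, ha.mul hb, by ring⟩

theorem IsIntegralMultiple.sub {d : ℕ} {z w : ℂ} (hz : IsIntegralMultiple d z)
    (hw : IsIntegralMultiple d w) : IsIntegralMultiple d (z - w) := by
  rw [sub_eq_add_neg, neg_eq_neg_one_mul]
  exact hz.add (hw.mul_left isIntegral_one.neg)

theorem IsIntegralMultiple.sum {ι : Type*} {d : ℕ} (s : Finset ι) {f : ι → ℂ}
    (h : ∀ i ∈ s, IsIntegralMultiple d (f i)) : IsIntegralMultiple d (∑ i ∈ s, f i) := by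
  induction s using Finset.induction_on with
  | empty => simpa using IsIntegralMultiple.zero d
  | insert a s ha ih =>
    rw [Finset.sum_insert ha]
    exact (h a (Finset.mem_insert_self _ _)).add (ih fun i hi => h i (Finset.mem_insert_of_mem hi))

theorem IsIntegralMultiple.of_dvd {d e : ℕ} (hde : d ∣ e) {z : ℂ} (hz : IsIntegralMultiple e z) :
    IsIntegralMultiple d z := by
  obtain ⟨k, rfl⟩ := hde
  obtain ⟨b, hb, rfl⟩ := hz
  exact ⟨k * b, (isIntegral_natCast_complex k).mul hb, by push_cast; ring⟩

theorem isIntegralMultiple_natCast_mul {d n : ℕ} (h : d ∣ n) {a : ℂ} (ha : IsIntegral ℤ a) :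
    IsIntegralMultiple d (n * a) := by
  obtain ⟨k, rfl⟩ := h
  exact ⟨k * a, (isIntegral_natCast_complex k).mul ha, by push_cast; ring⟩

theorem isIntegral_of_forall_prime {α : ℂ}
    (h : ∀ q : ℕ, q.Prime → ∃ m : ℕ, ¬ q ∣ m ∧ IsIntegral ℤ (m * α)) : IsIntegral ℤ α := by
  let I : Ideal ℤ :=
    { carrier := {n : ℤ | IsIntegral ℤ ((n : ℂ) * α)}
      add_mem' := fun {a b} ha hb => by
        simp only [Set.mem_ofPred_eq] at ha hb ⊢
        push_cast
        rw [add_mul]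
        exact ha.add hb
      zero_mem' := by simpa using isIntegral_zero
      smul_mem' := fun c a ha => by
        simp only [Set.mem_ofPred_eq, smul_eq_mul] at ha ⊢
        push_cast
        rw [mul_assoc]
        exact IsIntegral.mul (isIntegral_algebraMap (R := ℤ) (A := ℂ) (x := c)) ha }
  obtain ⟨g, hg⟩ := (IsPrincipalIdealRing.principal I).principal
  have hg' : I = Ideal.span {g} := hg
  by_cases hu : IsUnit g
  · have : (1 : ℤ) ∈ I := by
      rw [hg', Ideal.span_singleton_eq_top.2 hu]
      trivial
    have : IsIntegral ℤ (((1 : ℤ) : ℂ) * α) := this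
    simpa using this
  · obtain ⟨q, hq, hqg⟩ := Nat.exists_prime_and_dvd
      (fun h1 : g.natAbs = 1 => hu (Int.isUnit_iff_natAbs_eq.2 h1))
    obtain ⟨m, hm, hm'⟩ := h q hq
    have hmI : (m : ℤ) ∈ I := by
      have : IsIntegral ℤ (((m : ℤ) : ℂ) * α) := by exact_mod_cast hm'
      exact this
    rw [hg', Ideal.mem_span_singleton] at hmI
    exact absurd (Int.natCast_dvd_natCast.1 ((Int.natCast_dvd.2 hqg).trans hmI)) hm

section Averages

theorem IsCharacter.sum_coset_isIntegralMultiple {G : Type} [Group G] [Fintype G] {θ : G → ℂ}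
    (hθ : IsCharacter G θ) (R : Subgroup G) (c : G) (hc : ∀ s ∈ R, c * s = s * c) :
    IsIntegralMultiple (Nat.card R) (∑ s : R, θ (c * s)) := by
  obtain ⟨V, _, _, _, ρ, rfl⟩ := isCharacter_iff_representation.1 hθ
  have hR : (Nat.card R : ℂ) ≠ 0 := card_ne_zero_complex
  set E : Module.End ℂ V := (Nat.card R : ℂ)⁻¹ • ∑ s : R, ρ s with hE
  have hsE : ∀ s : R, ρ s * E = E := by
    intro s
    rw [hE, mul_smul_comm, Finset.mul_sum]
    congr 1
    refine Fintype.sum_equiv (Equiv.mulLeft s) _ _ fun t => ?_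
    rw [← map_mul]
    rfl
  have hEE : E * E = E := by
    nth_rewrite 1 [hE]
    rw [smul_mul_assoc, Finset.sum_mul, Finset.sum_congr rfl fun s _ => hsE s]
    rw [Finset.sum_const, Finset.card_univ, ← Nat.card_eq_fintype_card, ← Nat.cast_smul_eq_nsmul ℂ,
      smul_smul, inv_mul_cancel₀ hR, one_smul]
  have hcE : ρ c * E = E * ρ c := by
    rw [hE, mul_smul_comm, smul_mul_assoc, Finset.mul_sum, Finset.sum_mul]
    congr 1
    refine Finset.sum_congr rfl fun s _ => ?_
    rw [← map_mul, ← map_mul, hc s s.2]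
  set B : Module.End ℂ V := ρ c * E + (1 - E) with hB
  have hBk : ∀ k : ℕ, B ^ k = ρ c ^ k * E + (1 - E) := by
    intro k
    induction k with
    | zero => simp
    | succ k ih =>
      rw [pow_succ, ih, hB]
      have h1 : ρ c ^ k * E * (ρ c * E) = ρ c ^ (k + 1) * E := by
        rw [hcE, mul_assoc, ← mul_assoc E E, hEE, ← hcE, ← mul_assoc, ← pow_succ]
      have h2 : ρ c ^ k * E * (1 - E) = 0 := by
        rw [mul_assoc, mul_sub, mul_one, hEE, sub_self, mul_zero]
      have h3 : (1 - E) * (ρ c * E) = 0 := by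
        rw [hcE, sub_mul, one_mul, ← mul_assoc, hEE, sub_self]
      have h4 : (1 - E) * (1 - E) = 1 - E := by
        rw [mul_sub, mul_one, sub_mul, one_mul, hEE, sub_self, sub_zero]
      rw [add_mul, mul_add, mul_add, h1, h2, h3, h4, add_zero, zero_add]
  have hN : 0 < orderOf c := orderOf_pos c
  obtain ⟨s, m, h1, h2⟩ := trace_pow_eq_sum_roots_of_unity B hN (by
    rw [hBk, ← map_pow, pow_orderOf_eq_one, map_one, one_mul, add_sub_cancel])
  have hBint : IsIntegral ℤ (LinearMap.trace ℂ V B) := by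
    have h3 := h2 1
    rw [pow_one] at h3
    rw [h3]
    refine IsIntegral.sum _ fun z hz => (isIntegral_natCast_complex _).mul ?_
    rw [pow_one]
    exact IsIntegral.of_pow hN (by rw [h1 z hz]; exact isIntegral_one)
  have hEint : IsIntegral ℤ (LinearMap.trace ℂ V E) := by
    have := Representation.card_inv_mul_sum_char_eq_finrank (ρ.comp R.subtype)
    have h4 : LinearMap.trace ℂ V E = Module.finrank ℂ (Representation.invariants
        (ρ.comp R.subtype)) := by
      rw [← this, hE, map_smul, map_sum, smul_eq_mul]
      rfl
    rw [h4]
    exact isIntegral_natCast_complex _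
  refine ⟨LinearMap.trace ℂ V (ρ c * E), ?_, ?_⟩
  · have : LinearMap.trace ℂ V (ρ c * E) =
        LinearMap.trace ℂ V B - (Module.finrank ℂ V - LinearMap.trace ℂ V E) := by
      rw [hB, map_add, map_sub, LinearMap.trace_one]
      ring
    rw [this]
    exact hBint.sub ((isIntegral_natCast_complex _).sub hEint)
  · rw [hE, mul_smul_comm, map_smul, Finset.mul_sum, map_sum, smul_eq_mul,
      mul_inv_cancel_left₀ hR]
    refine Finset.sum_congr rfl fun s _ => ?_
    rw [Representation.character, map_mul]

theorem isIntegral_of_sum_smul_eq_smul_one {G : Type} [Group G] [Fintype G] {V : Type}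
    [AddCommGroup V] [Module ℂ V] [Nontrivial V] (ρ : Representation ℂ G V) {a : G → ℂ}
    (ha : ∀ x, IsIntegral ℤ (a x)) {c : ℂ} (h : ∑ x, a x • ρ x = c • (1 : Module.End ℂ V)) :
    IsIntegral ℤ c := by
  let O := integralClosure ℤ ℂ
  let S : Subalgebra O (Module.End ℂ V) := Algebra.adjoin O (Set.range ρ)
  have hcl : (Submonoid.closure (Set.range ρ) : Set (Module.End ℂ V)) = Set.range ρ := by
    have : (Set.range ρ) = ((MonoidHom.mrange ρ : Submonoid (Module.End ℂ V)) :
        Set (Module.End ℂ V)) := rfl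
    rw [this, Submonoid.closure_eq]
  have hS : (Subalgebra.toSubmodule S).FG := by
    rw [Algebra.adjoin_eq_span, hcl]
    exact Submodule.fg_span (Set.finite_range ρ)
  have hT : (∑ x, a x • ρ x) ∈ S := by
    refine Subalgebra.sum_mem _ fun x _ => ?_
    have : a x • ρ x = (⟨a x, ha x⟩ : O) • ρ x := rfl
    rw [this]
    exact Subalgebra.smul_mem _ (Algebra.subset_adjoin (Set.mem_range_self x)) _
  have hint : IsIntegral O (∑ x, a x • ρ x) := IsIntegral.of_mem_of_fg S hS _ hT
  rw [h, ← Algebra.algebraMap_eq_smul_one] at hint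
  have hinj : Function.Injective (algebraMap ℂ (Module.End ℂ V)) :=
    FaithfulSMul.algebraMap_injective ℂ _
  exact isIntegral_trans c ((isIntegral_algebraMap_iff hinj).1 hint)

end Averages

section Orbits

open MulAction

theorem sum_isIntegralMultiple_of_orbit {G X : Type} [Group G] [Fintype X] [MulAction G X]
    {h : X → ℂ} {d : ℕ} (hinv : ∀ (g : G) x, h (g • x) = h x)
    (hd : ∀ x, IsIntegralMultiple d (Nat.card (orbit G x) * h x)) :
    IsIntegralMultiple d (∑ x, h x) := by
  rw [← Finset.sum_fiberwise Finset.univ (fun x => (Quotient.mk (orbitRel G X) x))]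
  refine IsIntegralMultiple.sum _ fun ω _ => ?_
  induction ω using Quotient.inductionOn with
  | _ x =>
  have h1 : ∀ y ∈ Finset.univ.filter
      (fun y => Quotient.mk (orbitRel G X) y = Quotient.mk (orbitRel G X) x), h y = h x := by
    intro y hy
    obtain ⟨g, rfl⟩ := Quotient.exact (Finset.mem_filter.1 hy).2
    exact hinv g x
  rw [Finset.sum_congr rfl h1, Finset.sum_const, nsmul_eq_mul]
  have h2 : (Finset.univ.filter
      (fun y => Quotient.mk (orbitRel G X) y = Quotient.mk (orbitRel G X) x)).card =
      Nat.card (orbit G x) := by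
    rw [Nat.card_eq_fintype_card, Fintype.card_of_subtype]
    intro y
    simp only [Finset.mem_filter, Finset.mem_univ, true_and]
    exact ⟨fun h => Quotient.exact h, fun h => Quotient.sound h⟩
  rw [h2]
  exact hd x

theorem sum_primary_isIntegralMultiple {C : Type} [Group C] [Fintype C] {q : ℕ} (hq : q.Prime)
    {F : C → ℂ} (hF : ∀ s, IsIntegral ℤ (F s)) (hconj : ∀ s g, F (g * s * g⁻¹) = F s)
    (hR : ∀ R : Subgroup C, IsPGroup q R → IsIntegralMultiple (Nat.card R) (∑ s : R, F s)) :
    IsIntegralMultiple (pPart q (Nat.card C))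
      (∑ s : C, if ∃ k, s ^ q ^ k = 1 then F s else 0) := by
  have := Fact.mk hq
  set d := pPart q (Nat.card C) with hd
  obtain ⟨Q⟩ : Nonempty (Sylow q C) := inferInstance
  let Y := C ⧸ (Q : Subgroup C)
  let k := Nat.totient d
  have hdpos : 0 < d := pow_pos hq.pos _
  have hk : 0 < k := Nat.totient_pos.2 hdpos
  let n : C → ℕ := fun s => Nat.card {y : Y // s • y = y}
  have hstab : ∀ ω : Fin k → Y, IsPGroup q (stabilizer C ω) := by
    intro ω
    have h1 : stabilizer C ω ≤ stabilizer C (ω ⟨0, hk⟩) := by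
      intro g hg
      exact congrFun (mem_stabilizer_iff.1 hg) ⟨0, hk⟩
    refine IsPGroup.to_le ?_ h1
    obtain ⟨g, hg⟩ := QuotientGroup.mk_surjective (ω ⟨0, hk⟩)
    have h2 : ω ⟨0, hk⟩ = g • ((1 : C) : Y) := by
      rw [← hg]
      change _ = ((g * 1 : C) : Y)
      rw [mul_one]
    rw [h2, stabilizer_smul_eq_stabilizer_map_conj, MulAction.stabilizer_quotient]
    exact Q.isPGroup'.map _
  have hsum : ∑ s, (n s : ℂ) ^ k * F s =
      ∑ ω : Fin k → Y, ∑ s : stabilizer C ω, F s := by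
    have h1 : ∀ ω : Fin k → Y, ∑ s : stabilizer C ω, F s =
        ∑ s : C, if s • ω = ω then F s else 0 := by
      intro ω
      rw [← Finset.sum_filter]
      refine (Finset.sum_subtype _ (fun s => ?_) _).symm
      simp
    simp only [h1]
    rw [Finset.sum_comm]
    refine Finset.sum_congr rfl fun s _ => ?_
    rw [← Finset.sum_filter, Finset.sum_const, nsmul_eq_mul]
    congr 1
    rw [← Nat.cast_pow]
    congr 1
    have e : {ω : Fin k → Y // s • ω = ω} ≃ (Fin k → {y : Y // s • y = y}) :=
      { toFun := fun ω i => ⟨ω.1 i, congrFun ω.2 i⟩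
        invFun := fun ω => ⟨fun i => (ω i).1, funext fun i => (ω i).2⟩
        left_inv := fun _ => rfl
        right_inv := fun _ => rfl }
    have h3 := Nat.card_congr e
    rw [Nat.card_fun, Nat.card_eq_fintype_card (α := Fin k), Fintype.card_fin] at h3
    rw [← h3, Nat.card_eq_fintype_card, Fintype.card_subtype]
  have hint : IsIntegralMultiple (Nat.card C) (∑ s, (n s : ℂ) ^ k * F s) := by
    rw [hsum]
    refine sum_isIntegralMultiple_of_orbit (G := C) ?_ ?_
    · intro g ω
      refine (Fintype.sum_equiv ((MulAut.conj g).toEquiv.subtypeEquiv fun s => ?_) _ _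
        fun s => ?_).symm
      · simp only [mem_stabilizer_iff, MulEquiv.toEquiv_eq_coe, MulEquiv.coe_toEquiv,
          MulAut.conj_apply, mul_smul, inv_smul_smul]
        exact (smul_left_cancel_iff g).symm
      · exact (hconj s g).symm
    · intro ω
      obtain ⟨w, hw, hw'⟩ := hR _ (hstab ω)
      refine ⟨w, hw, ?_⟩
      have hw2 : ∑ s : stabilizer C ω, F s = Nat.card (stabilizer C ω) * w := by
        convert hw'
      rw [hw2, ← mul_assoc, ← Nat.cast_mul]
      congr 2
      have := card_orbit_mul_card_stabilizer_eq_card_group C ω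
      simpa only [Nat.card_eq_fintype_card] using this
  have hmod : ∀ s : C, (∃ j, s ^ q ^ j = 1) → d ∣ n s ^ k - 1 ∧ n s ≠ 0 := by
    intro s hs
    have hp : IsPGroup q (Subgroup.zpowers s) := by
      obtain ⟨j, hj⟩ := hs
      obtain ⟨i, _, hi⟩ := (Nat.dvd_prime_pow hq).1 (orderOf_dvd_of_pow_eq_one hj)
      exact IsPGroup.of_card (n := i) (by rw [Nat.card_zpowers, hi])
    have h1 := hp.card_modEq_card_fixedPoints Y
    have h2 : Nat.card (fixedPoints (Subgroup.zpowers s) Y) = n s := by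
      refine Nat.card_congr (Equiv.subtypeEquivRight fun y => ?_)
      constructor
      · intro h
        exact h ⟨s, Subgroup.mem_zpowers s⟩
      · rintro h ⟨g, hg⟩
        obtain ⟨i, rfl⟩ := Subgroup.mem_zpowers_iff.1 hg
        have : s ∈ stabilizer C y := h
        exact Subgroup.zpow_mem _ this i
    rw [h2] at h1
    have h3 : ¬ q ∣ n s := by
      intro h
      have : q ∣ Nat.card Y := (Nat.ModEq.dvd_iff h1 dvd_rfl).2 h
      exact Q.not_dvd_index this
    have h4 : Nat.Coprime (n s) d :=
      Nat.Coprime.pow_right _ ((Nat.Prime.coprime_iff_not_dvd hq).2 h3).symm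
    have h5 := (Nat.ModEq.pow_totient h4).symm
    have h6 : n s ≠ 0 := fun h => h3 (h ▸ dvd_zero q)
    exact ⟨(Nat.modEq_iff_dvd' (Nat.one_le_iff_ne_zero.2 (pow_ne_zero _ h6))).1 h5, h6⟩
  have hzero : ∀ s : C, ¬ (∃ j, s ^ q ^ j = 1) → n s = 0 := by
    intro s hs
    refine Nat.card_eq_zero.2 (Or.inl ⟨fun y => hs ?_⟩)
    have hmem : s ∈ stabilizer C (fun _ : Fin k => y.1) := funext fun _ => y.2
    obtain ⟨j, hj⟩ := hstab _ ⟨s, hmem⟩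
    exact ⟨j, congrArg Subtype.val hj⟩
  have hdC : d ∣ Nat.card C := Nat.ordProj_dvd _ _
  have hfin : ∑ s : C, (if ∃ k, s ^ q ^ k = 1 then F s else 0) =
      ∑ s, (n s : ℂ) ^ k * F s -
        ∑ s, (if ∃ j, s ^ q ^ j = 1 then (((n s ^ k - 1 : ℕ) : ℂ)) * F s else 0) := by
    rw [← Finset.sum_sub_distrib]
    refine Finset.sum_congr rfl fun s _ => ?_
    split_ifs with hs
    · have h1 : 1 ≤ n s ^ k := Nat.one_le_iff_ne_zero.2 (pow_ne_zero _ (hmod s hs).2)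
      rw [Nat.cast_sub h1]
      push_cast
      ring
    · rw [hzero s hs]
      simp [hk.ne']
  rw [hfin]
  refine (hint.of_dvd hdC).sub (IsIntegralMultiple.sum _ fun s _ => ?_)
  split_ifs with hs
  · exact isIntegralMultiple_natCast_mul (hmod s hs).1 (hF s)
  · exact IsIntegralMultiple.zero _

end Orbits

theorem pPart_mul (p : ℕ) {a b : ℕ} (ha : a ≠ 0) (hb : b ≠ 0) :
    pPart p (a * b) = pPart p a * pPart p b := by
  rw [pPart, Nat.factorization_mul ha hb, Finsupp.add_apply, pow_add, pPart, pPart]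

theorem pPart_dvd (p n : ℕ) : pPart p n ∣ n := Nat.ordProj_dvd n p

theorem exists_mul_pPart {p n : ℕ} (hp : p.Prime) (hn : n ≠ 0) :
    ∃ m, n = pPart p n * m ∧ ¬ p ∣ m :=
  ⟨n / p ^ n.factorization p, (Nat.ordProj_mul_ordCompl_eq_self n p).symm,
    Nat.not_dvd_ordCompl hp hn⟩

theorem pow_pPart_card_eq_one {G : Type} [Group G] [Finite G] {q : ℕ} (hq : q.Prime) {s : G}
    {k : ℕ} (hs : s ^ q ^ k = 1) : s ^ pPart q (Nat.card G) = 1 := by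
  obtain ⟨i, _, hi⟩ := (Nat.dvd_prime_pow hq).1 (orderOf_dvd_of_pow_eq_one hs)
  refine orderOf_dvd_iff_pow_eq_one.1 ?_
  rw [hi, pPart]
  refine pow_dvd_pow _ ?_
  rw [← hq.pow_dvd_iff_le_factorization Nat.card_pos.ne', ← hi]
  exact orderOf_dvd_natCard s

theorem sum_isIntegralMultiple_pPart {G : Type} [Group G] [Fintype G] {q M : ℕ} (hq : q.Prime)
    (hM : Nat.card G = pPart q (Nat.card G) * M) (hqM : ¬ q ∣ M)
    {Φ : G → ℂ} (hΦ : ∀ s, IsIntegral ℤ (Φ s)) (hconj : ∀ s g, Φ (g * s * g⁻¹) = Φ s)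
    (hR : ∀ c : G, c ^ M = 1 → ∀ R : Subgroup G, IsPGroup q R → (∀ s ∈ R, c * s = s * c) →
      IsIntegralMultiple (Nat.card R) (∑ s : R, Φ (c * s))) :
    IsIntegralMultiple (pPart q (Nat.card G)) (∑ x, Φ x) := by
  set d := pPart q (Nat.card G) with hd
  have hcop : Nat.Coprime M d :=
    (Nat.Coprime.pow_left _ ((Nat.Prime.coprime_iff_not_dvd hq).2 hqM)).symm
  obtain ⟨m, hm1, hm0⟩ := Nat.chineseRemainder hcop 1 0
  have hdm : d ∣ m := (Nat.modEq_zero_iff_dvd).1 hm0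
  have hpowM : ∀ c : G, c ^ M = 1 → c ^ m = c := by
    intro c hc
    have := pow_eq_pow_iff_modEq.2 (hm1.of_dvd (orderOf_dvd_of_pow_eq_one hc))
    rw [this, pow_one]
  rw [← Finset.sum_fiberwise Finset.univ (fun x => x ^ m)]
  refine sum_isIntegralMultiple_of_orbit (G := ConjAct G) ?_ ?_
  · intro g c
    refine (Finset.sum_equiv (MulAut.conj (ConjAct.ofConjAct g)).toEquiv (fun x => ?_)
      fun x _ => ?_).symm
    · simp [ConjAct.smul_def, conj_pow]
    · exact (hconj _ _).symm
  · intro c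
    by_cases hc : c ^ M = 1
    swap
    · rw [Finset.filter_false_of_mem, Finset.sum_empty, mul_zero]
      · exact IsIntegralMultiple.zero _
      · rintro x - rfl
        refine hc ?_
        rw [← pow_mul]
        obtain ⟨t, rfl⟩ := hdm
        rw [mul_right_comm, ← hM, pow_mul, pow_card_eq_one', one_pow]
    let C := Subgroup.centralizer {c}
    have hcC : ∀ s : C, c * s = s * c := fun s =>
      (Subgroup.mem_centralizer_singleton_iff.1 s.2).symm
    have hsum : ∑ x ∈ Finset.univ.filter (fun x => x ^ m = c), Φ x =
        ∑ s : C, if ∃ k, s ^ q ^ k = 1 then Φ (c * s) else 0 := by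
      rw [← Finset.sum_filter]
      symm
      refine Finset.sum_bij (fun s _ => c * s) ?_ ?_ ?_ ?_
      · intro s hs
        obtain ⟨k, hk⟩ := (Finset.mem_filter.1 hs).2
        have h1 : (s : G) ^ d = 1 := pow_pPart_card_eq_one hq (congrArg Subtype.val hk)
        refine Finset.mem_filter.2 ⟨Finset.mem_univ _, ?_⟩
        have hcomm : Commute c (s : G) := hcC s
        rw [hcomm.mul_pow, hpowM c hc, orderOf_dvd_iff_pow_eq_one.1
          ((orderOf_dvd_of_pow_eq_one h1).trans hdm), mul_one]
      · intro a _ b _ hab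
        exact Subtype.ext (mul_left_cancel hab)
      · intro x hx
        have hx' : x ^ m = c := (Finset.mem_filter.1 hx).2
        have hcx : Commute c x := hx' ▸ (Commute.refl x).pow_left m
        have hmem : c⁻¹ * x ∈ C := by
          refine Subgroup.mem_centralizer_singleton_iff.2 ?_
          rw [mul_assoc, ← hcx.eq]
          group
        refine ⟨⟨c⁻¹ * x, hmem⟩, Finset.mem_filter.2 ⟨Finset.mem_univ _,
          (Nat.card G).factorization q, Subtype.ext ?_⟩, by simp⟩
        change (c⁻¹ * x) ^ d = 1
        rw [hcx.inv_left.mul_pow, inv_pow, inv_mul_eq_one, ← hx', ← pow_mul]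
        refine pow_eq_pow_iff_modEq.2 (Nat.ModEq.of_dvd (orderOf_dvd_natCard x) ?_)
        rw [hM, mul_comm m d]
        simpa using Nat.ModEq.mul_left' d hm1
      · intro s _
        rfl
    rw [hsum]
    obtain ⟨w, hw, hw'⟩ := sum_primary_isIntegralMultiple (C := C) hq (F := fun s => Φ (c * s))
      (fun s => hΦ _) (by
        intro s g
        rw [← hconj (c * s) g]
        congr 1
        push_cast
        rw [← mul_assoc, ← mul_assoc, ← mul_assoc, hcC g])
      (by
        intro R hRp
        have h1 := hR c hc (R.map C.subtype) (hRp.map _) (by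
          rintro _ ⟨s, -, rfl⟩
          exact hcC s)
        rw [Subgroup.card_map_of_injective C.subtype_injective] at h1
        convert h1 using 1
        exact Fintype.sum_equiv (R.equivMapOfInjective C.subtype C.subtype_injective).toEquiv _ _
          fun s => rfl)
    rw [hw', ← mul_assoc, ← Nat.cast_mul]
    refine isIntegralMultiple_natCast_mul ?_ hw
    have h1 : Nat.card (MulAction.orbit (ConjAct G) c) * Nat.card C = Nat.card G := by
      have h2 := MulAction.card_orbit_mul_card_stabilizer_eq_card_group (ConjAct G) c
      rw [Subgroup.nat_card_centralizer_nat_card_stabilizer]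
      simp only [← Nat.card_eq_fintype_card] at h2
      exact h2
    have h3 : Nonempty (MulAction.orbit (ConjAct G) c) := ⟨⟨c, MulAction.mem_orbit_self c⟩⟩
    rw [hd, ← h1, pPart_mul q Nat.card_pos.ne' Nat.card_pos.ne']
    exact Nat.mul_dvd_mul (pPart_dvd _ _) dvd_rfl

/-- `w` is the image of the algebraic number `z` under the automorphism `σ`. -/
def GalRel (σ : algebraicClosure ℚ ℂ ≃ₐ[ℚ] algebraicClosure ℚ ℂ) (z w : ℂ) : Prop :=
  ∃ a : algebraicClosure ℚ ℂ, (a : ℂ) = z ∧ (σ a : ℂ) = w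

section GalRel

variable {σ : algebraicClosure ℚ ℂ ≃ₐ[ℚ] algebraicClosure ℚ ℂ} {z w z' w' : ℂ}

theorem GalRel.mul (h : GalRel σ z w) (h' : GalRel σ z' w') : GalRel σ (z * z') (w * w') := by
  obtain ⟨a, rfl, rfl⟩ := h
  obtain ⟨b, rfl, rfl⟩ := h'
  exact ⟨a * b, by simp, by simp⟩

theorem GalRel.add (h : GalRel σ z w) (h' : GalRel σ z' w') : GalRel σ (z + z') (w + w') := by
  obtain ⟨a, rfl, rfl⟩ := h
  obtain ⟨b, rfl, rfl⟩ := h'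
  exact ⟨a + b, by simp, by simp⟩

theorem GalRel.inv (h : GalRel σ z w) : GalRel σ z⁻¹ w⁻¹ := by
  obtain ⟨a, rfl, rfl⟩ := h
  exact ⟨a⁻¹, by simp, by simp⟩

theorem GalRel.natCast (n : ℕ) : GalRel σ n n := ⟨n, by simp, by simp⟩

theorem GalRel.zero : GalRel σ 0 0 := ⟨0, by simp, by simp⟩

theorem GalRel.sum {ι : Type*} {s : Finset ι} {f g : ι → ℂ} (h : ∀ i ∈ s, GalRel σ (f i) (g i)) :
    GalRel σ (∑ i ∈ s, f i) (∑ i ∈ s, g i) := by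
  induction s using Finset.induction_on with
  | empty => simpa using GalRel.zero
  | insert a s ha ih =>
    rw [Finset.sum_insert ha, Finset.sum_insert ha]
    exact (h a (Finset.mem_insert_self _ _)).add (ih fun i hi => h i (Finset.mem_insert_of_mem hi))

theorem exists_coprime_galRel_pow (σ : algebraicClosure ℚ ℂ ≃ₐ[ℚ] algebraicClosure ℚ ℂ) {N : ℕ}
    (hN : N ≠ 0) : ∃ k : ℕ, k.Coprime N ∧ ∀ z : ℂ, z ^ N = 1 → GalRel σ z (z ^ k) := by
  have hζ := Complex.isPrimitiveRoot_exp N hN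
  set ζ := Complex.exp (2 * Real.pi * Complex.I / N)
  have hmem : ζ ∈ algebraicClosure ℚ ℂ := by
    rw [mem_algebraicClosure_iff']
    exact (hζ.isIntegral (Nat.pos_of_ne_zero hN)).tower_top
  have hζ' : IsPrimitiveRoot (⟨ζ, hmem⟩ : algebraicClosure ℚ ℂ) N :=
    IsPrimitiveRoot.of_map_of_injective (f := (algebraicClosure ℚ ℂ).val) hζ
      (algebraicClosure ℚ ℂ).val.injective
  have : NeZero N := ⟨hN⟩
  obtain ⟨k, -, hk, hk'⟩ := (hζ'.isPrimitiveRoot_iff).1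
    (hζ'.map_of_injective (f := σ) σ.injective)
  refine ⟨k, hk, fun z hz => ?_⟩
  obtain ⟨i, -, rfl⟩ := hζ.eq_pow_of_pow_eq_one hz
  refine ⟨⟨ζ, hmem⟩ ^ i, by simp, ?_⟩
  rw [map_pow, ← hk', ← pow_mul, ← pow_mul, mul_comm k]
  simp

theorem IsCharacter.galRel {G : Type} [Group G] {χ : G → ℂ} (hχ : IsCharacter G χ) {x : G} {N k : ℕ}
    (hN : 0 < N) (hx : x ^ N = 1) (hk : ∀ z : ℂ, z ^ N = 1 → GalRel σ z (z ^ k)) :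
    GalRel σ (χ x) (χ (x ^ k)) := by
  obtain ⟨s, m, h1, h2⟩ := hχ.exists_sum_pow x hN hx
  have h3 := h2 1
  rw [pow_one] at h3
  rw [h3, h2]
  refine GalRel.sum fun z hz => (GalRel.natCast _).mul ?_
  rw [pow_one]
  exact hk z (h1 z hz)

end GalRel

theorem exists_intCast_eq_of_galRel {α : ℂ} (hα : IsIntegral ℤ α) (h : ∀ σ, GalRel σ α α) :
    ∃ n : ℤ, α = n := by
  have hmem : α ∈ algebraicClosure ℚ ℂ := by
    rw [mem_algebraicClosure_iff']
    exact hα.tower_top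
  have h1 : (⟨α, hmem⟩ : algebraicClosure ℚ ℂ) ∈
      (⊥ : IntermediateField ℚ (algebraicClosure ℚ ℂ)) := by
    have : IsAlgClosure ℚ (algebraicClosure ℚ ℂ) := algebraicClosure.isAlgClosure ℚ ℂ
    have : IsGalois ℚ (algebraicClosure ℚ ℂ) := IsAlgClosure.isGalois ℚ _
    rw [InfiniteGalois.mem_bot_iff_fixed]
    intro σ
    obtain ⟨a, ha, ha'⟩ := h σ
    have : a = ⟨α, hmem⟩ := Subtype.ext ha
    rw [← this]
    exact Subtype.ext (ha'.trans ha.symm)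
  obtain ⟨q, hq⟩ := IntermediateField.mem_bot.1 h1
  have hq' : algebraMap ℚ ℂ q = α := by
    have := congrArg (fun a : algebraicClosure ℚ ℂ => (a : ℂ)) hq
    simpa using this
  have h2 : IsIntegral ℤ q := by
    rw [← hq'] at hα
    exact (isIntegral_algebraMap_iff (algebraMap ℚ ℂ).injective).1 hα
  obtain ⟨n, rfl⟩ := IsIntegrallyClosed.isIntegral_iff.1 h2
  exact ⟨n, by rw [← hq']; simp⟩

theorem sum_galRel_self {G : Type} [Group G] [Fintype G]
    {σ : algebraicClosure ℚ ℂ ≃ₐ[ℚ] algebraicClosure ℚ ℂ} {f : G → ℂ} {k : ℕ}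
    (hk : k.Coprime (Nat.card G)) (h : ∀ x, GalRel σ (f x) (f (x ^ k))) :
    GalRel σ (∑ x, f x) (∑ x, f x) := by
  have h1 : ∑ x, f x = ∑ x, f (x ^ k) :=
    (Equiv.sum_comp (powCoprime hk.symm) f).symm
  have h2 := GalRel.sum (s := Finset.univ) fun x _ => h x
  rwa [← h1] at h2

section LinExt

variable {G : Type} [Group G] [Fintype G] {D : Subgroup G}

/-- A linear character of a normal subgroup is invariant under conjugation. -/
def InvariantLin (D : Subgroup G) [D.Normal] (μ : D →* ℂ) : Prop :=
  ∀ (g : G) (d : D), μ ⟨g * d * g⁻¹, Subgroup.Normal.conj_mem ‹_› _ d.2 g⟩ = μ d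

/-- The elements of `D` act on `χ` through the linear character `μ`. -/
def OverLin (D : Subgroup G) (μ : D →* ℂ) (χ : G → ℂ) : Prop :=
  ∀ (d : D) (x : G), χ (d * x) = μ d * χ x

omit [Fintype G] in
theorem InvariantLin.mul [D.Normal] {μ ν : D →* ℂ} (hμ : InvariantLin D μ)
    (hν : InvariantLin D ν) : InvariantLin D (μ * ν) := fun g d => by
  rw [MonoidHom.mul_apply, MonoidHom.mul_apply, hμ, hν]

/-- The complex conjugate of a linear character. -/
def conjLin (μ : D →* ℂ) : D →* ℂ := (starRingEnd ℂ).toMonoidHom.comp μ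

omit [Fintype G] in
theorem InvariantLin.conjLin [D.Normal] {μ : D →* ℂ} (hμ : InvariantLin D μ) :
    InvariantLin D (conjLin μ) := fun g d => congrArg (starRingEnd ℂ) (hμ g d)

omit [Fintype G] in
theorem InvariantLin.one [D.Normal] : InvariantLin D 1 := fun _ _ => rfl

theorem norm_lin (μ : D →* ℂ) (d : D) : ‖μ d‖ = 1 := by
  have h : μ d ^ Nat.card D = 1 := by rw [← map_pow, pow_card_eq_one', map_one]
  have h2 : ‖μ d‖ ^ Nat.card D = 1 := by rw [← norm_pow, h, norm_one]
  exact (pow_eq_one_iff_of_nonneg (norm_nonneg _) Nat.card_pos.ne').1 h2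

theorem lin_mul_conj (μ : D →* ℂ) (d : D) : μ d * (starRingEnd ℂ) (μ d) = 1 := by
  rw [Complex.mul_conj', norm_lin]
  simp

theorem lin_inv (μ : D →* ℂ) (d : D) : μ d⁻¹ = (starRingEnd ℂ) (μ d) := by
  have h1 : μ d⁻¹ * μ d = 1 := by rw [← map_mul, inv_mul_cancel, map_one]
  have h2 := lin_mul_conj μ d
  calc μ d⁻¹ = μ d⁻¹ * (μ d * (starRingEnd ℂ) (μ d)) := by rw [h2, mul_one]
    _ = (starRingEnd ℂ) (μ d) := by rw [← mul_assoc, h1, one_mul]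

theorem mul_conjLin (μ : D →* ℂ) : μ * conjLin μ = 1 := by
  ext d
  exact lin_mul_conj μ d

omit [Fintype G] in
theorem IsCharacter.overLin_apply_mul {χ : G → ℂ} [D.Normal] {μ : D →* ℂ}
    (hχ : IsCharacter G χ) (h : OverLin D μ χ) (x : G) (d : D) : χ (x * d) = μ d * χ x := by
  rw [← h d x, ← hχ.map_conj (x * d) (d : G)]
  congr 1
  group

/-- An irreducible representation with nonzero `μ`-isotypic part restricts to `D` as multiples
of the invariant linear character `μ`. -/
theorem Representation.IsIrreducible.eq_smul_one_of_sum_ne_zero [D.Normal] {V : Type}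
    [AddCommGroup V] [Module ℂ V] [FiniteDimensional ℂ V] {ρ : Representation ℂ G V}
    (h : ρ.IsIrreducible) {μ : D →* ℂ} (hμ : InvariantLin D μ)
    (h0 : ∑ d : D, μ d⁻¹ • ρ d ≠ 0) (d : D) : ρ d = μ d • (1 : Module.End ℂ V) := by
  set E := ∑ d : D, μ d⁻¹ • ρ d with hE
  have hcomm : ∀ g, E * ρ g = ρ g * E := by
    intro g
    rw [hE, Finset.sum_mul, Finset.mul_sum]
    symm
    refine Fintype.sum_equiv ((MulAut.conjNormal (H := D) g).toEquiv) _ _ fun s => ?_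
    have h1 : μ ((MulAut.conjNormal (H := D) g) s)⁻¹ = μ s⁻¹ := by
      rw [← map_inv, ← hμ g s⁻¹]
      congr 1
    change _ = μ ((MulAut.conjNormal (H := D) g) s)⁻¹ • ρ ((MulAut.conjNormal (H := D) g) s : G) * _
    rw [h1, mul_smul_comm, smul_mul_assoc, ← map_mul, ← map_mul, MulAut.conjNormal_apply]
    congr 2
    group
  have hdE : ρ d * E = μ d • E := by
    rw [hE, Finset.mul_sum, Finset.smul_sum]
    refine Fintype.sum_equiv (Equiv.mulLeft d) _ _ fun s => ?_
    have h1 : μ d * μ (d * s)⁻¹ = μ s⁻¹ := by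
      rw [mul_inv_rev, map_mul, mul_comm (μ s⁻¹), ← mul_assoc, ← map_mul, mul_inv_cancel, map_one,
        one_mul]
    rw [Equiv.coe_mulLeft, smul_smul, h1, mul_smul_comm, ← map_mul]
    rfl
  obtain ⟨c, hc⟩ := h.exists_smul_one E hcomm
  have hc0 : c ≠ 0 := by
    rintro rfl
    exact h0 (by rw [hc, zero_smul])
  rw [hc, mul_smul_comm, mul_one, smul_comm] at hdE
  exact smul_right_injective _ hc0 hdE

omit [Fintype G] in
theorem Representation.overLin_of_eq_smul_one {V : Type}
    [AddCommGroup V] [Module ℂ V] [FiniteDimensional ℂ V] {ρ : Representation ℂ G V}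
    {μ : D →* ℂ} (h : ∀ d : D, ρ d = μ d • (1 : Module.End ℂ V)) : OverLin D μ ρ.character := by
  intro d x
  rw [Representation.character, map_mul, h, smul_mul_assoc, one_mul, map_smul, smul_eq_mul]
  rfl

/-- An irreducible constituent of a class function lying over `μ` lies over `μ`. -/
theorem Representation.IsIrreducible.eq_smul_one_of_classInner_ne_zero [D.Normal] {V : Type}
    [AddCommGroup V] [Module ℂ V] [FiniteDimensional ℂ V] {ρ : Representation ℂ G V}
    (hρ : ρ.IsIrreducible) {μ : D →* ℂ} (hμ : InvariantLin D μ) {f : G → ℂ} (hf : OverLin D μ f)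
    (h0 : classInner f ρ.character ≠ 0) (d : D) : ρ d = μ d • (1 : Module.End ℂ V) := by
  refine hρ.eq_smul_one_of_sum_ne_zero hμ ?_ d
  intro hE
  refine h0 ?_
  have h1 : (Nat.card D : ℂ) * ∑ x, f x * (starRingEnd ℂ) (ρ.character x) = 0 := by
    calc (Nat.card D : ℂ) * ∑ x, f x * (starRingEnd ℂ) (ρ.character x)
        = ∑ _d : D, ∑ x, f x * (starRingEnd ℂ) (ρ.character x) := by
          rw [Finset.sum_const, Finset.card_univ, nsmul_eq_mul, Nat.card_eq_fintype_card]
      _ = ∑ d : D, ∑ x, f (d * x) * (starRingEnd ℂ) (ρ.character (d * x)) :=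
          Finset.sum_congr rfl fun d _ => (Equiv.sum_comp (Equiv.mulLeft (d : G))
            fun x => f x * (starRingEnd ℂ) (ρ.character x)).symm
      _ = ∑ x, f x * (starRingEnd ℂ) (LinearMap.trace ℂ V ((∑ d : D, μ d⁻¹ • ρ d) * ρ x)) := by
          rw [Finset.sum_comm]
          refine Finset.sum_congr rfl fun x _ => ?_
          rw [Finset.sum_mul, map_sum, map_sum, Finset.mul_sum]
          refine Finset.sum_congr rfl fun d _ => ?_
          rw [hf, smul_mul_assoc, map_smul, smul_eq_mul, map_mul, lin_inv, Complex.conj_conj,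
            ← map_mul]
          change μ d * f x * (starRingEnd ℂ) (LinearMap.trace ℂ V _) = _
          ring
      _ = 0 := by
          rw [hE]
          simp
  rw [classInner, (mul_eq_zero.1 h1).resolve_left card_ne_zero_complex, mul_zero]

theorem IsIrrChar.overLin_of_classInner_ne_zero [D.Normal] {μ : D →* ℂ} (hμ : InvariantLin D μ)
    {f ψ : G → ℂ} (hf : OverLin D μ f) (hψ : IsIrrChar G ψ) (h0 : classInner f ψ ≠ 0) :
    OverLin D μ ψ := by
  obtain ⟨V, _, _, _, ρ, hρ, rfl⟩ := hψ.exists_isIrreducible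
  exact Representation.overLin_of_eq_smul_one (hρ.eq_smul_one_of_classInner_ne_zero hμ hf h0)

theorem IsIrrChar.eq_smul_one_of_overLin [D.Normal] {V : Type}
    [AddCommGroup V] [Module ℂ V] [FiniteDimensional ℂ V] {ρ : Representation ℂ G V}
    (hρ : ρ.IsIrreducible) {μ : D →* ℂ} (hμ : InvariantLin D μ)
    (h : OverLin D μ ρ.character) (d : D) : ρ d = μ d • (1 : Module.End ℂ V) := by
  refine hρ.eq_smul_one_of_classInner_ne_zero hμ h ?_ d
  rw [hρ.isIrrChar.classInner_self]
  exact one_ne_zero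

/-- The extension of a linear character `μ` of `D` to `G` by `x ↦ μ (x ^ m)`, set to zero
where `x ^ m ∉ D`. -/
def linExt (D : Subgroup G) (m : ℕ) (μ : D →* ℂ) (x : G) : ℂ :=
  if h : x ^ m ∈ D then μ ⟨x ^ m, h⟩ else 0

variable {m : ℕ}

omit [Fintype G] in
theorem linExt_of_mem {μ : D →* ℂ} {x : G} (h : x ^ m ∈ D) :
    linExt D m μ x = μ ⟨x ^ m, h⟩ := dif_pos h

omit [Fintype G] in
theorem linExt_of_not_mem {μ : D →* ℂ} {x : G} (h : x ^ m ∉ D) : linExt D m μ x = 0 := dif_neg h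

omit [Fintype G] in
theorem linExt_mul (μ ν : D →* ℂ) : linExt D m (μ * ν) = linExt D m μ * linExt D m ν := by
  ext x
  by_cases h : x ^ m ∈ D
  · simp [linExt_of_mem h]
  · simp [linExt_of_not_mem h]

omit [Fintype G] in
theorem linExt_one_of_mem {x : G} (h : x ^ m ∈ D) : linExt D m 1 x = 1 := by
  rw [linExt_of_mem h, MonoidHom.one_apply]

theorem norm_linExt_of_mem (μ : D →* ℂ) {x : G} (h : x ^ m ∈ D) : ‖linExt D m μ x‖ = 1 := by
  rw [linExt_of_mem h, norm_lin]

theorem isIntegral_linExt (μ : D →* ℂ) (x : G) : IsIntegral ℤ (linExt D m μ x) := by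
  by_cases h : x ^ m ∈ D
  · rw [linExt_of_mem h]
    refine IsIntegral.of_pow (n := Nat.card D) Nat.card_pos ?_
    rw [← map_pow, pow_card_eq_one', map_one]
    exact isIntegral_one
  · rw [linExt_of_not_mem h]
    exact isIntegral_zero

omit [Fintype G] in
theorem linExt_conj [hD : D.Normal] {μ : D →* ℂ} (hμ : InvariantLin D μ) (x g : G) :
    linExt D m μ (g * x * g⁻¹) = linExt D m μ x := by
  have h0 : (g * x * g⁻¹) ^ m = g * x ^ m * g⁻¹ := conj_pow
  by_cases h : x ^ m ∈ D
  · have h1 : (g * x * g⁻¹) ^ m ∈ D := h0 ▸ hD.conj_mem _ h g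
    rw [linExt_of_mem h, linExt_of_mem h1, ← hμ g ⟨x ^ m, h⟩]
    simp only [h0]
  · have h1 : (g * x * g⁻¹) ^ m ∉ D := by
      intro h2
      rw [h0, hD.mem_comm_iff, inv_mul_cancel_left] at h2
      exact h h2
    rw [linExt_of_not_mem h, linExt_of_not_mem h1]

omit [Fintype G] in
theorem exists_mul_pow_eq [hD : D.Normal] {μ : D →* ℂ} (hμ : InvariantLin D μ) (x : G) (d : D)
    (k : ℕ) : ∃ e : D, ((d : G) * x) ^ k = e * x ^ k ∧ μ e = μ d ^ k := by
  induction k with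
  | zero => exact ⟨1, by simp, by simp⟩
  | succ k ih =>
    obtain ⟨e, he, he'⟩ := ih
    refine ⟨d * ⟨x * e * x⁻¹, hD.conj_mem _ e.2 x⟩, ?_, ?_⟩
    · rw [pow_succ', he, Subgroup.coe_mul, pow_succ']
      group
    · rw [map_mul, hμ, he', pow_succ']

omit [Fintype G] in
theorem overLin_linExt [hD : D.Normal] {μ : D →* ℂ} (hμ : InvariantLin D μ)
    (hm : ∀ d ∈ D, d ^ m = d) : OverLin D μ (linExt D m μ) := by
  intro d x
  obtain ⟨e, he, he'⟩ := exists_mul_pow_eq hμ x d m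
  have hd : μ d ^ m = μ d := by
    rw [← map_pow]
    congr 1
    exact Subtype.ext (hm d d.2)
  by_cases h : x ^ m ∈ D
  · have h1 : ((d : G) * x) ^ m ∈ D := he ▸ D.mul_mem e.2 h
    have h2 : (⟨((d : G) * x) ^ m, h1⟩ : D) = e * ⟨x ^ m, h⟩ := Subtype.ext he
    rw [linExt_of_mem h, linExt_of_mem h1, h2, map_mul, he', hd]
  · have h1 : ((d : G) * x) ^ m ∉ D := by
      rw [he, Subgroup.mul_mem_cancel_left _ e.2]
      exact h
    rw [linExt_of_not_mem h, linExt_of_not_mem h1, mul_zero]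

omit [Fintype G] in
theorem linExt_mul_of_pow_eq_one (μ : D →* ℂ) {c s : G} (hcs : c * s = s * c) (hs : s ^ m = 1) :
    linExt D m μ (c * s) = linExt D m μ c := by
  have h : (c * s) ^ m = c ^ m := by
    rw [(show Commute c s from hcs).mul_pow, hs, mul_one]
  simp only [linExt, h]

omit [Fintype G] in
theorem linExt_of_pow_eq_one (μ : D →* ℂ) {s : G} (hs : s ^ m = 1) : linExt D m μ s = 1 := by
  have h : s ^ m ∈ D := hs ▸ D.one_mem
  rw [linExt_of_mem h, ← map_one μ]
  congr 1
  exact Subtype.ext hs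

omit [Fintype G] in
theorem linExt_galRel {σ : algebraicClosure ℚ ℂ ≃ₐ[ℚ] algebraicClosure ℚ ℂ} (μ : D →* ℂ) {k : ℕ}
    (hk : k.Coprime (Nat.card G)) (hσ : ∀ z : ℂ, z ^ Nat.card G = 1 → GalRel σ z (z ^ k)) (x : G) :
    GalRel σ (linExt D m μ x) (linExt D m μ (x ^ k)) := by
  have h0 : (x ^ k) ^ m = (x ^ m) ^ k := pow_right_comm x k m
  by_cases h : x ^ m ∈ D
  · have h1 : (x ^ k) ^ m ∈ D := h0 ▸ D.pow_mem h k
    have h2 : (⟨(x ^ k) ^ m, h1⟩ : D) = ⟨x ^ m, h⟩ ^ k := Subtype.ext h0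
    rw [linExt_of_mem h, linExt_of_mem h1, h2, map_pow]
    refine hσ _ ?_
    rw [← map_pow, ← map_one μ]
    congr 1
    exact Subtype.ext (pow_card_eq_one' (x := x ^ m))
  · have h1 : (x ^ k) ^ m ∉ D := by
      rw [h0]
      intro h2
      obtain ⟨j, hj⟩ := exists_pow_eq_self_of_coprime (x := x ^ m)
        (hk.coprime_dvd_right (orderOf_dvd_natCard _))
      exact h (hj ▸ D.pow_mem h2 j)
    rw [linExt_of_not_mem h, linExt_of_not_mem h1]
    exact GalRel.zero

theorem exists_pow_exponent {p : ℕ} (hp : p.Prime) (hDp : IsPGroup p D) :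
    ∃ m, (∀ d ∈ D, d ^ m = d) ∧ ∀ s : G, ¬ p ∣ orderOf s → s ^ m = 1 := by
  obtain ⟨M, hM, hpM⟩ := exists_mul_pPart hp (Nat.card_pos (α := G)).ne'
  have hcop : Nat.Coprime (pPart p (Nat.card G)) M :=
    Nat.Coprime.pow_left _ ((Nat.Prime.coprime_iff_not_dvd hp).2 hpM)
  obtain ⟨m, hm1, hm0⟩ := Nat.chineseRemainder hcop 1 0
  refine ⟨m, fun d hd => ?_, fun s hs => ?_⟩
  · obtain ⟨k, hk⟩ := hDp ⟨d, hd⟩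
    have h1 : d ^ pPart p (Nat.card G) = 1 := pow_pPart_card_eq_one hp (congrArg Subtype.val hk)
    have := pow_eq_pow_iff_modEq.2 (hm1.of_dvd (orderOf_dvd_of_pow_eq_one h1))
    rw [this, pow_one]
  · refine orderOf_dvd_iff_pow_eq_one.1 (dvd_trans ?_ ((Nat.modEq_zero_iff_dvd).1 hm0))
    refine Nat.Coprime.dvd_of_dvd_mul_left (m := pPart p (Nat.card G)) ?_
      (hM ▸ orderOf_dvd_natCard s)
    exact (Nat.Coprime.pow_left _ ((Nat.Prime.coprime_iff_not_dvd hp).2 hs)).symm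

end LinExt

section Core

variable {G : Type} [Group G] [Fintype G] {D : Subgroup G}

theorem sum_eq_card_smul_sum_out (D : Subgroup G) {V : Type*} [AddCommGroup V] [Module ℂ V]
    {F : G → V} (hF : ∀ x, ∀ d : D, F (x * d) = F x) :
    ∑ x, F x = (Nat.card D : ℂ) •
      ∑ x, if x = Quotient.out (QuotientGroup.mk x : G ⧸ D) then F x else 0 := by
  have h1 : ∑ x, (if x = Quotient.out (QuotientGroup.mk x : G ⧸ D) then F x else 0) =
      ∑ c : G ⧸ D, F c.out := by
    rw [← Finset.sum_filter]
    refine (Finset.sum_bij (fun c _ => c.out) ?_ ?_ ?_ ?_).symm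
    · intro c _
      refine Finset.mem_filter.2 ⟨Finset.mem_univ _, ?_⟩
      rw [QuotientGroup.out_eq']
    · intro a _ b _ h
      exact Quotient.out_injective h
    · intro x hx
      exact ⟨QuotientGroup.mk x, Finset.mem_univ _, (Finset.mem_filter.1 hx).2.symm⟩
    · intro _ _
      rfl
  have hbij : Function.Bijective fun y : (G ⧸ D) × D => y.1.out * (y.2 : G) := by
    constructor
    · rintro ⟨c, d⟩ ⟨c', d'⟩ h
      have h2 : c = c' := by
        have h3 := congrArg (QuotientGroup.mk : G → G ⧸ D) h
        simpa using h3
      subst h2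
      exact Prod.ext rfl (Subtype.ext (mul_left_cancel h))
    · intro x
      obtain ⟨d, hd⟩ := QuotientGroup.mk_out_eq_mul D x
      exact ⟨⟨QuotientGroup.mk x, d⁻¹⟩, by simp [hd]⟩
  rw [h1, ← hbij.sum_comp, Fintype.sum_prod_type, Finset.smul_sum]
  refine Finset.sum_congr rfl fun c _ => ?_
  simp only [hF]
  rw [Finset.sum_const, Finset.card_univ, Nat.card_eq_fintype_card, ← Nat.cast_smul_eq_nsmul ℂ]

variable {p m : ℕ} [hD : D.Normal] {μ ν : D →* ℂ}

theorem exists_isIntegral_mul_classInner_self_prime (hm : ∀ d ∈ D, d ^ m = d) (hp : p.Prime)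
    (hμ : InvariantLin D μ) {ξ ψ : G → ℂ} (hξ : IsIrrChar G ξ) (hψ : IsIrrChar G ψ)
    (hξν : OverLin D ν ξ) (hψν : OverLin D (ν * μ) ψ) (hν : InvariantLin D ν)
    {n : ℕ} (hn : ξ 1 = n) (hnp : pPart p n = pPart p D.index) :
    ∃ M : ℕ, ¬ p ∣ M ∧ IsIntegral ℤ (M * classInner (ξ * linExt D m μ) ψ) := by
  obtain ⟨V, _, _, _, ρ, hρ, rfl⟩ := hξ.exists_isIrreducible
  have hρ1 : (Module.finrank ℂ V : ℂ) ≠ 0 := hρ.finrank_ne_zero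
  have hρn : Module.finrank ℂ V = n := by
    rw [Representation.char_one] at hn
    exact_mod_cast hn
  have hsc := IsIrrChar.eq_smul_one_of_overLin hρ hν hξν
  let b : G → ℂ := fun x => linExt D m μ x * (starRingEnd ℂ) (ψ x)
  have hb : ∀ x, IsIntegral ℤ (b x) := fun x =>
    (isIntegral_linExt μ x).mul (hψ.1.conj.isIntegral x)
  have hbconj : ∀ x g, b (g * x * g⁻¹) = b x := fun x g => by
    simp only [b, linExt_conj hμ, hψ.1.map_conj]
  have hF : ∀ x, ∀ d : D, b (x * d) • ρ (x * d) = b x • ρ x := by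
    intro x d
    have h1 : linExt D m μ (x * d) = μ d * linExt D m μ x := by
      rw [← overLin_linExt hμ hm d x, ← linExt_conj hμ (x * d) (d : G)]
      congr 1
      group
    have h2 := lin_mul_conj μ d
    have h3 := lin_mul_conj ν d
    simp only [b]
    rw [h1, hψ.1.overLin_apply_mul hψν, map_mul ρ, hsc, mul_smul_comm, mul_one, smul_smul]
    congr 1
    rw [MonoidHom.mul_apply, map_mul, map_mul]
    linear_combination linExt D m μ x * (starRingEnd ℂ) (ψ x) *
      (ν d * (starRingEnd ℂ) (ν d) * h2 + h3)
  have hsum := sum_eq_card_smul_sum_out D (F := fun x => b x • ρ x) hF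
  set T := ∑ x, b x • ρ x with hT
  have hcomm : ∀ g, T * ρ g = ρ g * T := by
    intro g
    rw [hT, Finset.sum_mul, Finset.mul_sum]
    symm
    refine Fintype.sum_equiv (MulAut.conj g).toEquiv _ _ fun s => ?_
    change _ = b (g * s * g⁻¹) • ρ (g * s * g⁻¹) * ρ g
    rw [hbconj, smul_mul_assoc, mul_smul_comm, ← map_mul, ← map_mul]
    congr 2
    group
  obtain ⟨c, hc⟩ := hρ.exists_smul_one T hcomm
  have hDc : (Nat.card D : ℂ) ≠ 0 := card_ne_zero_complex
  have hint : IsIntegral ℤ ((Nat.card D : ℂ)⁻¹ * c) := by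
    have : Nontrivial V := by
      refine Module.nontrivial_of_finrank_pos (R := ℂ) (Nat.pos_of_ne_zero ?_)
      exact_mod_cast hρ1
    refine isIntegral_of_sum_smul_eq_smul_one ρ (a := fun x =>
      if x = Quotient.out (QuotientGroup.mk x : G ⧸ D) then b x else 0) (fun x => ?_) ?_
    · split_ifs
      · exact hb x
      · exact isIntegral_zero
    · simp only [ite_smul, zero_smul]
      rw [mul_smul, ← hc, hsum, smul_smul, inv_mul_cancel₀ hDc, one_smul]
  have htr : (Nat.card G : ℂ) * classInner (ρ.character * linExt D m μ) ψ = c * n := by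
    have h1 := congrArg (LinearMap.trace ℂ V) hc
    rw [hT, map_sum, map_smul, smul_eq_mul, LinearMap.trace_one, hρn] at h1
    rw [← h1, classInner, mul_inv_cancel_left₀ card_ne_zero_complex]
    refine Finset.sum_congr rfl fun x _ => ?_
    rw [map_smul, smul_eq_mul, Pi.mul_apply]
    change LinearMap.trace ℂ V (ρ x) * _ * _ = linExt D m μ x * _ * _
    ring
  have hn0 : n ≠ 0 := by
    rintro rfl
    exact hρ1 (by rw [hρn, Nat.cast_zero])
  obtain ⟨M₁, hM₁, -⟩ := exists_mul_pPart hp hn0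
  obtain ⟨M₂, hM₂, hpM₂⟩ := exists_mul_pPart hp (Subgroup.index_ne_zero_of_finite (H := D))
  refine ⟨M₂, hpM₂, ?_⟩
  have hG : (Nat.card G : ℂ) = Nat.card D * (pPart p n * M₂) := by
    rw [← D.card_mul_index, hnp]
    conv_lhs => rw [hM₂]
    push_cast
    ring
  have hnM : (n : ℂ) = pPart p n * M₁ := by
    conv_lhs => rw [hM₁]
    push_cast
    rfl
  have hpp : (pPart p n : ℂ) ≠ 0 := Nat.cast_ne_zero.2 (pow_ne_zero _ hp.ne_zero)
  have hfin : (M₂ : ℂ) * classInner (ρ.character * linExt D m μ) ψ =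
      M₁ * ((Nat.card D : ℂ)⁻¹ * c) := by
    rw [hG, hnM] at htr
    field_simp
    refine mul_left_cancel₀ hpp ?_
    linear_combination htr
  rw [hfin]
  exact (isIntegral_natCast_complex _).mul hint

theorem exists_isIntegral_mul_classInner_prime_ne {q : ℕ} (hq : q.Prime) (hp : p.Prime)
    (hqp : q ≠ p) (hm : ∀ s : G, ¬ p ∣ orderOf s → s ^ m = 1)
    (hμ : InvariantLin D μ) {ξ ψ : G → ℂ} (hξ : IsCharacter G ξ) (hψ : IsCharacter G ψ) :
    ∃ M : ℕ, ¬ q ∣ M ∧ IsIntegral ℤ (M * classInner (ξ * linExt D m μ) ψ) := by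
  obtain ⟨M, hM, hqM⟩ := exists_mul_pPart hq (Nat.card_pos (α := G)).ne'
  refine ⟨M, hqM, ?_⟩
  let θ : G → ℂ := ξ * fun x => (starRingEnd ℂ) (ψ x)
  have hθ : IsCharacter G θ := hξ.mul hψ.conj
  obtain ⟨w, hw, hw'⟩ := sum_isIntegralMultiple_pPart (Φ := fun x => linExt D m μ x * θ x) hq hM hqM
    (fun s => (isIntegral_linExt μ s).mul (hθ.isIntegral s))
    (fun s g => by simp only [linExt_conj hμ, hθ.map_conj])
    (by
      intro c _ R hR hcR
      have h1 : ∀ s : R, linExt D m μ (c * s) * θ (c * s) = linExt D m μ c * θ (c * s) := by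
        intro s
        rw [linExt_mul_of_pow_eq_one μ (hcR s s.2) (hm _ ?_)]
        obtain ⟨k, hk⟩ := hR s
        intro hps
        have h2 : p ∣ q ^ k :=
          hps.trans (orderOf_dvd_of_pow_eq_one (by simpa using congrArg Subtype.val hk))
        exact hqp ((Nat.prime_dvd_prime_iff_eq hp hq).1 (hp.dvd_of_dvd_pow h2)).symm
      rw [Finset.sum_congr rfl fun s _ => h1 s, ← Finset.mul_sum]
      exact (hθ.sum_coset_isIntegralMultiple R c hcR).mul_left (isIntegral_linExt μ c))
  have hqq : (pPart q (Nat.card G) : ℂ) ≠ 0 := Nat.cast_ne_zero.2 (pow_ne_zero _ hq.ne_zero)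
  have hfin : (M : ℂ) * classInner (ξ * linExt D m μ) ψ = w := by
    refine mul_left_cancel₀ hqq ?_
    rw [← hw', ← mul_assoc, ← Nat.cast_mul, ← hM, classInner,
      mul_inv_cancel_left₀ card_ne_zero_complex]
    refine Finset.sum_congr rfl fun x _ => ?_
    simp only [θ, Pi.mul_apply]
    ring
  rw [hfin]
  exact hw

theorem exists_intCast_eq_classInner (hp : p.Prime) (hm : ∀ d ∈ D, d ^ m = d)
    (hm' : ∀ s : G, ¬ p ∣ orderOf s → s ^ m = 1) (hμ : InvariantLin D μ) (hν : InvariantLin D ν)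
    {ξ ψ : G → ℂ} (hξ : IsIrrChar G ξ) (hψ : IsIrrChar G ψ)
    (hξν : OverLin D ν ξ) (hψν : OverLin D (ν * μ) ψ)
    {n : ℕ} (hn : ξ 1 = n) (hnp : pPart p n = pPart p D.index) :
    ∃ a : ℤ, classInner (ξ * linExt D m μ) ψ = a := by
  refine exists_intCast_eq_of_galRel (isIntegral_of_forall_prime fun q hq => ?_) fun σ => ?_
  · by_cases hqp : q = p
    · subst hqp
      exact exists_isIntegral_mul_classInner_self_prime hm hq hμ hξ hψ hξν hψν hν hn hnp
    · exact exists_isIntegral_mul_classInner_prime_ne hq hp hqp hm' hμ hξ.1 hψ.1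
  · obtain ⟨k, hk, hσ⟩ := exists_coprime_galRel_pow σ (Nat.card_pos (α := G)).ne'
    refine (GalRel.natCast _).inv.mul (sum_galRel_self hk fun x => ?_)
    have hx : x ^ Nat.card G = 1 := pow_card_eq_one'
    refine ((hξ.1.galRel Nat.card_pos hx hσ).mul (linExt_galRel μ hk hσ x)).mul ?_
    exact hψ.1.conj.galRel Nat.card_pos hx hσ

theorem pow_mem_of_ne_zero (hp : p.Prime) (hm : ∀ d ∈ D, d ^ m = d)
    (hm' : ∀ s : G, ¬ p ∣ orderOf s → s ^ m = 1) (hν : InvariantLin D ν)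
    {ξ : G → ℂ} (hξ : IsIrrChar G ξ) (hξν : OverLin D ν ξ)
    {n : ℕ} (hn : ξ 1 = n) (hnp : pPart p n = pPart p D.index) {x : G} (hx : ξ x ≠ 0) :
    x ^ m ∈ D := by
  obtain ⟨a, ha⟩ := exists_intCast_eq_classInner (μ := 1) hp hm hm' InvariantLin.one hν hξ hξ hξν
    (by rwa [mul_one]) hn hnp
  set f := ξ * linExt D m 1 with hf
  have hff : classInner f f = classInner f ξ := by
    unfold classInner
    congr 1
    refine Finset.sum_congr rfl fun y _ => ?_
    by_cases hy : y ^ m ∈ D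
    · simp [hf, linExt_one_of_mem hy]
    · simp [hf, linExt_of_not_mem hy]
  have hgg : classInner (ξ - f) (ξ - f) = 1 - classInner f ξ := by
    rw [← hξ.classInner_self, ← classInner_sub_left]
    unfold classInner
    congr 1
    refine Finset.sum_congr rfl fun y _ => ?_
    by_cases hy : y ^ m ∈ D
    · simp [hf, linExt_one_of_mem hy]
    · simp [hf, linExt_of_not_mem hy]
  rw [ha] at hff hgg
  have h0 : 0 ≤ a := by
    rw [classInner_self] at hff
    have h1 : ((Nat.card G : ℝ)⁻¹ * ∑ x, ‖f x‖ ^ 2 : ℝ) = a := by exact_mod_cast hff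
    have h2 : (0 : ℝ) ≤ a := h1 ▸ by positivity
    exact_mod_cast h2
  have h1 : a ≤ 1 := by
    rw [classInner_self] at hgg
    have h1 : ((Nat.card G : ℝ)⁻¹ * ∑ x, ‖(ξ - f) x‖ ^ 2 : ℝ) = 1 - a := by exact_mod_cast hgg
    have h2 : (0 : ℝ) ≤ 1 - a := h1 ▸ by positivity
    have h3 : (a : ℝ) ≤ 1 := by linarith
    exact_mod_cast h3
  have h2 : a ≠ 0 := by
    rintro rfl
    rw [Int.cast_zero, classInner_self_eq_zero] at hff
    have h3 := congrFun hff 1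
    rw [hf, Pi.mul_apply, linExt_of_pow_eq_one _ (one_pow m), mul_one] at h3
    exact hξ.1.degree_ne_zero hξ.2.1 h3
  have h3 : a = 1 := by omega
  rw [h3, Int.cast_one, sub_self, classInner_self_eq_zero] at hgg
  by_contra hxm
  have h4 := congrFun hgg x
  rw [Pi.sub_apply, hf, Pi.mul_apply, linExt_of_not_mem hxm, mul_zero, sub_zero] at h4
  exact hx h4

/-- Multiplication by the extended linear character preserves irreducible characters of relative
defect zero. -/
theorem isIrrChar_mul_linExt (hp : p.Prime) (hm : ∀ d ∈ D, d ^ m = d)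
    (hm' : ∀ s : G, ¬ p ∣ orderOf s → s ^ m = 1) (hμ : InvariantLin D μ) (hν : InvariantLin D ν)
    {ξ : G → ℂ} (hξ : IsIrrChar G ξ) (hξν : OverLin D ν ξ)
    {n : ℕ} (hn : ξ 1 = n) (hnp : pPart p n = pPart p D.index) :
    IsIrrChar G (ξ * linExt D m μ) := by
  set f := ξ * linExt D m μ with hf
  have hff : classInner f f = 1 := by
    rw [← hξ.classInner_self, classInner_self, classInner_self]
    congr 2
    refine Finset.sum_congr rfl fun y _ => ?_
    by_cases hy : ξ y = 0
    · simp [hf, hy]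
    · rw [hf, Pi.mul_apply, norm_mul, norm_linExt_of_mem μ
        (pow_mem_of_ne_zero hp hm hm' hν hξ hξν hn hnp hy), mul_one]
  have hfo : OverLin D (ν * μ) f := fun d x => by
    rw [hf, Pi.mul_apply, Pi.mul_apply, hξν, overLin_linExt hμ hm, MonoidHom.mul_apply]
    ring
  have hf0 : f ≠ 0 := fun h => by
    rw [classInner_self_eq_zero.2 h] at hff
    exact zero_ne_one hff
  obtain ⟨ψ, hψ, hψ0⟩ := exists_isIrrChar_classInner_ne_zero (f := f)
    (fun x g => by rw [hf, Pi.mul_apply, Pi.mul_apply, hξ.1.map_conj, linExt_conj hμ]) hf0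
  have hψo := hψ.overLin_of_classInner_ne_zero (hν.mul hμ) hfo hψ0
  obtain ⟨a, ha⟩ := exists_intCast_eq_classInner hp hm hm' hμ hν hξ hψ hξν hψo hn hnp
  have hg : classInner (f - (a : ℂ) • ψ) (f - (a : ℂ) • ψ) = 1 - (a : ℂ) ^ 2 := by
    have h1 : ∀ g : G → ℂ, classInner g ((a : ℂ) • ψ) = a * classInner g ψ := fun g => by
      rw [← classInner_conj, classInner_smul_left, map_mul, classInner_conj, map_intCast]
    have h2 : ∀ g : G → ℂ, classInner g (f - (a : ℂ) • ψ) = classInner g f - a * classInner g ψ :=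
      fun g => by
        rw [← classInner_conj, classInner_sub_left, map_sub, classInner_conj, classInner_conj, h1]
    rw [h2, classInner_sub_left, classInner_sub_left, classInner_smul_left, classInner_smul_left,
      hψ.classInner_self, ← classInner_conj f ψ, ha, hff, map_intCast]
    ring
  have ha2 : a ^ 2 ≤ 1 := by
    rw [classInner_self] at hg
    have h1 : ((Nat.card G : ℝ)⁻¹ * ∑ x, ‖(f - (a : ℂ) • ψ) x‖ ^ 2 : ℝ) = 1 - (a : ℝ) ^ 2 := by
      exact_mod_cast hg
    have h2 : (0 : ℝ) ≤ 1 - (a : ℝ) ^ 2 := h1 ▸ by positivity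
    have h3 : (a : ℝ) ^ 2 ≤ 1 := by linarith
    exact_mod_cast h3
  have ha0 : a ≠ 0 := by
    rintro rfl
    exact hψ0 (by rw [ha, Int.cast_zero])
  have hcase : a = 1 ∨ a = -1 := by
    have h1 : -1 ≤ a := by nlinarith
    have h2 : a ≤ 1 := by nlinarith
    omega
  have ha1 : (a : ℂ) ^ 2 = 1 := by
    rcases hcase with rfl | rfl <;> norm_num
  rw [ha1, sub_self, classInner_self_eq_zero, sub_eq_zero] at hg
  obtain ⟨k, hk⟩ := hψ.1.exists_degree
  have h1 := congrFun hg 1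
  rw [hf, Pi.mul_apply, linExt_of_pow_eq_one _ (one_pow m), mul_one, hn, Pi.smul_apply, hk,
    smul_eq_mul] at h1
  have hn0 : n ≠ 0 := by
    rintro rfl
    exact hξ.1.degree_ne_zero hξ.2.1 (by rw [hn, Nat.cast_zero])
  rcases hcase with rfl | rfl
  · rw [hg, Int.cast_one, one_smul]
    exact hψ
  · exfalso
    have h2 : (n : ℤ) = -k := by
      have : (n : ℂ) = -k := by simpa using h1
      exact_mod_cast this
    omega

end Core

section Surjective

variable {A G : Type} [Group A] [Fintype A] [Group G] [Fintype G] {π : A →* G}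

theorem classInner_comp_of_surjective (hπ : Function.Surjective π) (f g : G → ℂ) :
    classInner (f ∘ π) (g ∘ π) = classInner f g := by
  let k := (Finset.univ.filter fun a => π a = 1).card
  have hsum : ∀ F : G → ℂ, ∑ a, F (π a) = k * ∑ y, F y := by
    intro F
    rw [← Finset.sum_fiberwise Finset.univ π, Finset.mul_sum]
    refine Finset.sum_congr rfl fun y _ => ?_
    have h1 : ∑ a ∈ Finset.univ.filter (fun a => π a = y), F (π a) =
        ∑ a ∈ Finset.univ.filter (fun a => π a = y), F y :=
      Finset.sum_congr rfl fun a ha => by rw [(Finset.mem_filter.1 ha).2]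
    rw [h1, Finset.sum_const, nsmul_eq_mul]
    congr 2
    exact MonoidHom.card_fiber_eq_of_mem_range π (hπ y) (hπ 1)
  have hcard : (Nat.card A : ℂ) = k * Nat.card G := by
    simpa [Nat.card_eq_fintype_card] using hsum fun _ => 1
  have hA : (Nat.card A : ℂ) ≠ 0 := card_ne_zero_complex
  have hk : (k : ℂ) ≠ 0 := fun h => hA (by rw [hcard, h, zero_mul])
  unfold classInner
  have h2 := hsum fun y => f y * (starRingEnd ℂ) (g y)
  simp only [Function.comp_apply]
  rw [h2, hcard, mul_inv, mul_mul_mul_comm, inv_mul_cancel₀ hk, one_mul]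

theorem IsIrrChar.comp_of_surjective (hπ : Function.Surjective π) {f : G → ℂ}
    (hf : IsIrrChar G f) : IsIrrChar A (f ∘ π) := by
  refine (hf.1.comp π).isIrrChar_of_classInner ?_
  exact (classInner_comp_of_surjective hπ f f).trans hf.classInner_self

theorem IsIrrChar.exists_eq_comp (hπ : Function.Surjective π) {χ : A → ℂ} (hχ : IsIrrChar A χ)
    (h : OverLin π.ker 1 χ) : ∃ f, IsIrrChar G f ∧ χ = f ∘ π := by
  obtain ⟨V, _, _, _, ρ, hρ, rfl⟩ := hχ.exists_isIrreducible
  have h1 := IsIrrChar.eq_smul_one_of_overLin hρ InvariantLin.one h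
  have h2 : ∀ a b, π a = π b → ρ a = ρ b := by
    intro a b hab
    have h3 : a * b⁻¹ ∈ π.ker := by rw [MonoidHom.mem_ker, map_mul, map_inv, hab, mul_inv_cancel]
    have h4 := h1 ⟨a * b⁻¹, h3⟩
    rw [MonoidHom.one_apply, one_smul] at h4
    calc ρ a = ρ (a * b⁻¹) * ρ b := by rw [← map_mul, inv_mul_cancel_right]
      _ = ρ b := by rw [h4, one_mul]
  let ρ' : Representation ℂ G V :=
    { toFun := fun g => ρ (Function.surjInv hπ g)
      map_one' := by
        rw [h2 _ 1 (by rw [Function.surjInv_eq hπ, map_one]), map_one]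
      map_mul' := fun x y => by
        rw [← map_mul]
        exact h2 _ _ (by rw [map_mul, Function.surjInv_eq hπ, Function.surjInv_eq hπ,
          Function.surjInv_eq hπ]) }
  have h3 : ρ.character = ρ'.character ∘ π := by
    ext a
    change LinearMap.trace ℂ V (ρ a) = LinearMap.trace ℂ V (ρ (Function.surjInv hπ (π a)))
    rw [h2 a _ (Function.surjInv_eq hπ (π a)).symm]
  refine ⟨ρ'.character, (isCharacter_character ρ').isIrrChar_of_classInner ?_, h3⟩
  rw [← classInner_comp_of_surjective hπ, ← h3, hχ.classInner_self]

end Surjective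

section RelDefZero

variable {G : Type} [Group G] [Fintype G]

/-- The irreducible characters over the linear character `ν` of `D` of relative defect zero. -/
def relDefZero (p : ℕ) (D : Subgroup G) (ν : D →* ℂ) : Set (G → ℂ) :=
  {χ | IsIrrChar G χ ∧ OverLin D ν χ ∧ ∃ n : ℕ, χ 1 = n ∧ pPart p n = pPart p D.index}

variable {D : Subgroup G} {p m : ℕ} [D.Normal] {μ ν : D →* ℂ}

theorem mapsTo_mul_linExt (hp : p.Prime) (hm : ∀ d ∈ D, d ^ m = d)
    (hm' : ∀ s : G, ¬ p ∣ orderOf s → s ^ m = 1) (hμ : InvariantLin D μ)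
    (hν : InvariantLin D ν) :
    Set.MapsTo (fun χ => χ * linExt D m μ) (relDefZero p D ν) (relDefZero p D (ν * μ)) := by
  rintro χ ⟨h1, h2, n, h3, h4⟩
  refine ⟨isIrrChar_mul_linExt hp hm hm' hμ hν h1 h2 h3 h4, fun d x => ?_, n, ?_, h4⟩
  · simp only [Pi.mul_apply, h2 d x, overLin_linExt hμ hm d x, MonoidHom.mul_apply]
    ring
  · simp only [Pi.mul_apply, linExt_of_pow_eq_one _ (one_pow m), mul_one, h3]

theorem mul_linExt_one (hp : p.Prime) (hm : ∀ d ∈ D, d ^ m = d)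
    (hm' : ∀ s : G, ¬ p ∣ orderOf s → s ^ m = 1)
    (hν : InvariantLin D ν) {χ : G → ℂ} (hχ : χ ∈ relDefZero p D ν) :
    χ * linExt D m 1 = χ := by
  obtain ⟨h1, h2, n, h3, h4⟩ := hχ
  ext x
  by_cases hx : χ x = 0
  · simp [hx]
  · rw [Pi.mul_apply, linExt_one_of_mem (pow_mem_of_ne_zero hp hm hm' hν h1 h2 h3 h4 hx), mul_one]

theorem bijOn_mul_linExt (hp : p.Prime) (hm : ∀ d ∈ D, d ^ m = d)
    (hm' : ∀ s : G, ¬ p ∣ orderOf s → s ^ m = 1) (hμ : InvariantLin D μ)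
    (hν : InvariantLin D ν) :
    Set.BijOn (fun χ => χ * linExt D m μ) (relDefZero p D ν) (relDefZero p D (ν * μ)) := by
  have hback := mapsTo_mul_linExt hp hm hm' hμ.conjLin (hν.mul hμ)
  rw [mul_assoc, mul_conjLin, mul_one] at hback
  refine Set.InvOn.bijOn (f' := fun χ => χ * linExt D m (conjLin μ)) ⟨?_, ?_⟩
    (mapsTo_mul_linExt hp hm hm' hμ hν) hback
  · intro χ hχ
    simp only
    rw [mul_assoc, ← linExt_mul, mul_conjLin, mul_linExt_one hp hm hm' hν hχ]
  · intro χ hχ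
    simp only
    rw [mul_assoc, ← linExt_mul, mul_comm (conjLin μ), mul_conjLin,
      mul_linExt_one hp hm hm' (hν.mul hμ) hχ]

omit [D.Normal] in
theorem bijOn_comp_of_surjective {H : Type} [Group H] [Fintype H] {π : G →* H}
    (hπ : Function.Surjective π) (hker : π.ker = D) :
    Set.BijOn (fun χ : H → ℂ => χ ∘ π)
      {χ | IsIrrChar H χ ∧ ∃ n : ℕ, χ 1 = n ∧ pPart p n = pPart p (Nat.card H)}
      (relDefZero p D 1) := by
  subst hker
  have hidx : Nat.card H = π.ker.index := by
    rw [Subgroup.index_ker, MonoidHom.range_eq_top.2 hπ, Subgroup.card_top]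
  refine ⟨?_, ?_, ?_⟩
  · rintro χ ⟨h1, n, h3, h4⟩
    refine ⟨h1.comp_of_surjective hπ, fun d x => ?_, n, ?_, hidx ▸ h4⟩
    · simp only [Function.comp_apply]
      rw [map_mul, (MonoidHom.mem_ker).1 d.2, one_mul, MonoidHom.one_apply, one_mul]
    · simp only [Function.comp_apply]
      rw [map_one, h3]
  · intro χ _ ψ _ h
    exact hπ.injective_comp_right h
  · rintro χ ⟨h1, h2, n, h3, h4⟩
    obtain ⟨f, hf, rfl⟩ := h1.exists_eq_comp hπ h2
    exact ⟨f, ⟨hf, n, by simpa using h3, hidx ▸ h4⟩, rfl⟩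

end RelDefZero

section Schur

variable {D : Type} [Group D] [Fintype D] {V : Type} [AddCommGroup V] [Module ℂ V]
  [FiniteDimensional ℂ V] {ρ : Representation ℂ D V}

theorem Representation.IsIrreducible.sum_conj_eq (hρ : ρ.IsIrreducible) (M : Module.End ℂ V) :
    ∑ d, ρ d * M * ρ d⁻¹ =
      ((Nat.card D : ℂ) * LinearMap.trace ℂ V M * (Module.finrank ℂ V : ℂ)⁻¹) •
        (1 : Module.End ℂ V) := by
  have hcomm : ∀ g, (∑ d, ρ d * M * ρ d⁻¹) * ρ g = ρ g * ∑ d, ρ d * M * ρ d⁻¹ := by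
    intro g
    rw [Finset.sum_mul, Finset.mul_sum]
    symm
    refine Fintype.sum_equiv (Equiv.mulLeft g) _ _ fun d => ?_
    rw [Equiv.coe_mulLeft, mul_assoc (ρ (g * d) * M), ← map_mul, map_mul ρ g d, mul_inv_rev,
      inv_mul_cancel_right]
    simp only [mul_assoc]
  obtain ⟨c, hc⟩ := hρ.exists_smul_one _ hcomm
  have htr := congrArg (LinearMap.trace ℂ V) hc
  have h1 : ∀ d, LinearMap.trace ℂ V (ρ d * M * ρ d⁻¹) = LinearMap.trace ℂ V M := by
    intro d
    rw [LinearMap.trace_mul_comm, ← mul_assoc, ← map_mul, inv_mul_cancel, map_one, one_mul]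
  rw [map_sum, Finset.sum_congr rfl fun d _ => h1 d, Finset.sum_const, Finset.card_univ, map_smul,
    LinearMap.trace_one, nsmul_eq_mul, smul_eq_mul, ← Nat.card_eq_fintype_card] at htr
  rw [hc, htr, mul_assoc, mul_inv_cancel₀ hρ.finrank_ne_zero, mul_one]

/-- Schur orthogonality for the matrix coefficients of an irreducible representation. -/
theorem Representation.IsIrreducible.sum_trace_mul_trace (hρ : ρ.IsIrreducible)
    (X Y : Module.End ℂ V) :
    ∑ d, LinearMap.trace ℂ V (ρ d * X) * LinearMap.trace ℂ V (Y * ρ d⁻¹) =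
      (Nat.card D : ℂ) * LinearMap.trace ℂ V (Y * X) * (Module.finrank ℂ V : ℂ)⁻¹ := by
  let b := Module.finBasis ℂ V
  have htr : ∀ T : Module.End ℂ V, LinearMap.trace ℂ V T = ∑ i, b.coord i (T (b i)) := by
    intro T
    rw [LinearMap.trace_eq_matrix_trace ℂ b, Matrix.trace]
    simp [LinearMap.toMatrix_apply]
  let r : _ → _ → Module.End ℂ V := fun i j => (b.coord j).smulRight (b i)
  have hr : ∀ i j u, r i j u = b.coord j u • b i := fun i j u => rfl
  have h1 : ∀ d, LinearMap.trace ℂ V (ρ d * X) * LinearMap.trace ℂ V (Y * ρ d⁻¹) =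
      ∑ i, ∑ j, b.coord i ((ρ d * (X * r i j * Y) * ρ d⁻¹) (b j)) := by
    intro d
    rw [htr, htr, Finset.sum_mul_sum]
    refine Finset.sum_congr rfl fun i _ => Finset.sum_congr rfl fun j _ => ?_
    simp only [Module.End.mul_apply, hr, map_smul, smul_eq_mul]
    ring
  have h2 : ∀ i j, LinearMap.trace ℂ V (X * r i j * Y) = b.coord j ((Y * X) (b i)) := by
    intro i j
    rw [LinearMap.trace_mul_comm, ← mul_assoc, LinearMap.trace_mul_comm, htr]
    have h3 : ∀ k, b.coord k ((r i j * (Y * X)) (b k)) =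
        b.coord j ((Y * X) (b k)) * (if i = k then 1 else 0) := by
      intro k
      rw [Module.End.mul_apply, hr, map_smul, smul_eq_mul]
      simp [Finsupp.single_apply]
    rw [Finset.sum_congr rfl fun k _ => h3 k]
    simp
  rw [Finset.sum_congr rfl fun d _ => h1 d, Finset.sum_comm]
  have h4 : ∀ i, ∑ d, ∑ j, b.coord i ((ρ d * (X * r i j * Y) * ρ d⁻¹) (b j)) =
      (Nat.card D : ℂ) * (b.coord i ((Y * X) (b i))) * (Module.finrank ℂ V : ℂ)⁻¹ := by
    intro i
    rw [Finset.sum_comm]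
    have h5 : ∀ j, ∑ d, b.coord i ((ρ d * (X * r i j * Y) * ρ d⁻¹) (b j)) =
        (Nat.card D : ℂ) * b.coord j ((Y * X) (b i)) * (Module.finrank ℂ V : ℂ)⁻¹ *
          (if j = i then 1 else 0) := by
      intro j
      rw [← map_sum, ← LinearMap.sum_apply, hρ.sum_conj_eq, h2, LinearMap.smul_apply, map_smul,
        smul_eq_mul]
      simp [Finsupp.single_apply]
    rw [Finset.sum_congr rfl fun j _ => h5 j]
    simp
  rw [Finset.sum_congr rfl fun i _ => h4 i, ← Finset.sum_mul, ← Finset.mul_sum, ← htr]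

/-- The degree of an irreducible representation divides the order of the group. -/
theorem Representation.IsIrreducible.finrank_dvd_card (hρ : ρ.IsIrreducible) :
    Module.finrank ℂ V ∣ Nat.card D := by
  have hn : (Module.finrank ℂ V : ℂ) ≠ 0 := hρ.finrank_ne_zero
  have : Nontrivial V := by
    refine Module.nontrivial_of_finrank_pos (R := ℂ) (Nat.pos_of_ne_zero ?_)
    exact_mod_cast hn
  have hχ := isCharacter_character ρ
  have hcomm : ∀ g, (∑ x, (starRingEnd ℂ) (ρ.character x) • ρ x) * ρ g =
      ρ g * ∑ x, (starRingEnd ℂ) (ρ.character x) • ρ x := by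
    intro g
    rw [Finset.sum_mul, Finset.mul_sum]
    symm
    refine Fintype.sum_equiv (MulAut.conj g).toEquiv _ _ fun s => ?_
    change _ = (starRingEnd ℂ) (ρ.character (g * s * g⁻¹)) • ρ (g * s * g⁻¹) * ρ g
    rw [hχ.map_conj, smul_mul_assoc, mul_smul_comm, ← map_mul, ← map_mul]
    congr 2
    group
  obtain ⟨c, hc⟩ := hρ.exists_smul_one _ hcomm
  have hint := isIntegral_of_sum_smul_eq_smul_one ρ (fun x => hχ.conj.isIntegral x) hc
  have htr := congrArg (LinearMap.trace ℂ V) hc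
  have h1 := hρ.isIrrChar.classInner_self
  rw [classInner, inv_mul_eq_one₀ card_ne_zero_complex] at h1
  have h2 : (Nat.card D : ℂ) = c * Module.finrank ℂ V := by
    rw [map_sum, map_smul, LinearMap.trace_one, smul_eq_mul] at htr
    rw [h1, ← htr]
    refine Finset.sum_congr rfl fun x _ => ?_
    rw [map_smul, smul_eq_mul, mul_comm]
    rfl
  have h3 : c = algebraMap ℚ ℂ ((Nat.card D : ℚ) / Module.finrank ℂ V) := by
    rw [eq_ratCast, Rat.cast_div, Rat.cast_natCast, Rat.cast_natCast, eq_div_iff hn, h2]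
  rw [h3, isIntegral_algebraMap_iff (algebraMap ℚ ℂ).injective] at hint
  obtain ⟨k, hk⟩ := IsIntegrallyClosed.isIntegral_iff.1 hint
  have hn' : (Module.finrank ℂ V : ℚ) ≠ 0 := by exact_mod_cast hn
  have hk' : (k : ℚ) = (Nat.card D : ℚ) / Module.finrank ℂ V := hk
  rw [eq_div_iff hn'] at hk'
  have h4 : (k : ℤ) * Module.finrank ℂ V = Nat.card D := by exact_mod_cast hk'
  exact Int.natCast_dvd_natCast.1 ⟨k, by rw [← h4, mul_comm]⟩

end Schur

section Correspondence

variable {A G : Type} [Group A] [Fintype A] [Group G] [Fintype G] {D : Subgroup G}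
  [hD : D.Normal] {V : Type} [AddCommGroup V] [Module ℂ V] [FiniteDimensional ℂ V]
  {τ : Representation ℂ A V} {π : A →* G} {j : D →* A}

omit [Fintype A] hD in
theorem Representation.IsIrreducible.smul_right_cancel
    (hirr : Representation.IsIrreducible (τ.comp j : Representation ℂ D V)) {x : A} {b c : ℂ}
    (h : b • τ x = c • τ x) : b = c := by
  have h1 := congrArg (fun T => LinearMap.trace ℂ V (T * τ x⁻¹)) h
  simp only [smul_mul_assoc, ← map_mul, mul_inv_cancel, map_one, map_smul, LinearMap.trace_one,
    smul_eq_mul] at h1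
  exact mul_right_cancel₀ hirr.finrank_ne_zero h1

omit [Fintype A] in
/-- The linear character of the preimage of `D` that compares `τ` with its values on `j`. -/
theorem exists_invariantLin_smul_eq
    (hirr : Representation.IsIrreducible (τ.comp j : Representation ℂ D V))
    (hN : ∀ x (e : D), τ x * τ (j e) = τ (j ⟨π x * e * (π x)⁻¹, hD.conj_mem _ e.2 _⟩) * τ x) :
    ∃ l : D.comap π →* ℂ, InvariantLin (D.comap π) l ∧
      ∀ z : D.comap π, l z • τ z = τ (j ⟨π z, z.2⟩) := by
  have hex : ∀ z : D.comap π, ∃ c : ℂ, c • τ z = τ (j ⟨π z, z.2⟩) := by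
    intro z
    have hcomm : ∀ e, (τ (z : A)⁻¹ * τ (j ⟨π z, z.2⟩)) * (τ.comp j : Representation ℂ D V) e =
        (τ.comp j : Representation ℂ D V) e * (τ (z : A)⁻¹ * τ (j ⟨π z, z.2⟩)) := by
      intro e
      have h1 := hN z e
      have h2 : (⟨π z * e * (π z)⁻¹, hD.conj_mem _ e.2 _⟩ : D) =
          ⟨π z, z.2⟩ * e * ⟨π z, z.2⟩⁻¹ := Subtype.ext rfl
      rw [h2] at h1
      have h3 : τ (z : A)⁻¹ * τ z = 1 := by rw [← map_mul, inv_mul_cancel, map_one]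
      have h3' : τ z * τ (z : A)⁻¹ = 1 := by rw [← map_mul, mul_inv_cancel, map_one]
      have h4 : τ (j ⟨π z, z.2⟩) * τ (j e) =
          τ (j (⟨π z, z.2⟩ * e * ⟨π z, z.2⟩⁻¹)) * τ (j ⟨π z, z.2⟩) := by
        rw [← map_mul, ← map_mul, ← map_mul, ← map_mul, inv_mul_cancel_right]
      change τ (z : A)⁻¹ * τ (j ⟨π z, z.2⟩) * τ (j e) = τ (j e) * _
      calc τ (z : A)⁻¹ * τ (j ⟨π z, z.2⟩) * τ (j e)
          = τ (z : A)⁻¹ * (τ (j (⟨π z, z.2⟩ * e * ⟨π z, z.2⟩⁻¹)) * (τ z * τ (z : A)⁻¹)) *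
              τ (j ⟨π z, z.2⟩) := by
            rw [h3', mul_one, mul_assoc, h4, ← mul_assoc]
        _ = τ (z : A)⁻¹ * ((τ z * τ (j e)) * τ (z : A)⁻¹) * τ (j ⟨π z, z.2⟩) := by
            rw [h1, mul_assoc (τ (j _)) (τ z)]
        _ = (τ (z : A)⁻¹ * τ z) * τ (j e) * (τ (z : A)⁻¹ * τ (j ⟨π z, z.2⟩)) := by
            simp only [mul_assoc]
        _ = _ := by rw [h3, one_mul]
    obtain ⟨c, hc⟩ := hirr.exists_smul_one _ hcomm
    refine ⟨c, ?_⟩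
    have h5 := congrArg (fun T => τ z * T) hc
    simp only [← mul_assoc, ← map_mul, mul_inv_cancel, one_mul, mul_smul_comm, mul_one] at h5
    exact h5.symm
  choose l hl using hex
  refine ⟨⟨⟨l, ?_⟩, ?_⟩, ?_, hl⟩
  · refine hirr.smul_right_cancel (x := 1) ?_
    have h := hl 1
    have h2 : (⟨π ((1 : D.comap π) : A), (1 : D.comap π).2⟩ : D) = 1 :=
      Subtype.ext (map_one π)
    rw [h2, map_one] at h
    rw [one_smul]
    exact h
  · intro y z
    refine hirr.smul_right_cancel (x := ((y * z : D.comap π) : A)) ?_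
    have h2 : (⟨π ((y * z : D.comap π) : A), (y * z).2⟩ : D) = ⟨π y, y.2⟩ * ⟨π z, z.2⟩ :=
      Subtype.ext (map_mul π _ _)
    change l (y * z) • _ = (l y * l z) • _
    rw [hl, h2, map_mul, map_mul, ← hl, ← hl, Subgroup.coe_mul, map_mul, smul_mul_smul_comm]
  · intro a z
    refine hirr.smul_right_cancel (x := a * z * a⁻¹) ?_
    change l _ • _ = l z • _
    have h1 := hl ⟨a * z * a⁻¹, Subgroup.Normal.conj_mem inferInstance _ z.2 a⟩
    rw [h1]
    have h2 : (⟨π (a * z * a⁻¹), Subgroup.Normal.conj_mem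
        (inferInstance : (D.comap π).Normal) _ z.2 a⟩ : D) =
        ⟨π a * (⟨π z, z.2⟩ : D) * (π a)⁻¹, hD.conj_mem _ z.2 _⟩ :=
      Subtype.ext (by simp)
    change τ (j (⟨π (a * z * a⁻¹), _⟩ : D)) = _
    have h3 := hN a ⟨π z, z.2⟩
    rw [← h2] at h3
    have h4 : τ (j ⟨π (a * z * a⁻¹), Subgroup.Normal.conj_mem
        (inferInstance : (D.comap π).Normal) _ z.2 a⟩) = τ a * τ (j ⟨π z, z.2⟩) * τ a⁻¹ := by
      rw [h3, mul_assoc (τ (j _)), ← map_mul τ a a⁻¹, mul_inv_cancel, map_one, mul_one]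
    refine h4.trans ?_
    rw [map_mul, map_mul, ← hl, mul_smul_comm, smul_mul_assoc]

variable {l : D.comap π →* ℂ}

omit hD [Fintype A] in
theorem apply_section_eq_one (hj : ∀ d, π (j d) = d)
    (hirr : Representation.IsIrreducible (τ.comp j : Representation ℂ D V))
    (hl : ∀ z : D.comap π, l z • τ z = τ (j ⟨π z, z.2⟩)) (d : D) (hd : j d ∈ D.comap π) :
    l ⟨j d, hd⟩ = 1 := by
  refine hirr.smul_right_cancel (x := j d) ?_
  have h := hl ⟨j d, hd⟩
  have h2 : (⟨π (j d), hd⟩ : D) = d := Subtype.ext (hj d)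
  change _ = τ (j ⟨π (j d), hd⟩) at h
  rw [h2] at h
  rw [h, one_smul]

omit hD in
theorem sum_character_mul_conj_mul
    (hirr : Representation.IsIrreducible (τ.comp j : Representation ℂ D V)) {F : A → ℂ}
    (hF : ∀ (d : D) x, F (j d * x) = F x) :
    ∑ x, τ.character x * (starRingEnd ℂ) (τ.character x) * F x = ∑ x, F x := by
  have hτ := isCharacter_character τ
  have h1 : ∀ d : D, ∑ x, τ.character x * (starRingEnd ℂ) (τ.character x) * F x =
      ∑ x, LinearMap.trace ℂ V ((τ.comp j : Representation ℂ D V) d * τ x) *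
        LinearMap.trace ℂ V (τ x⁻¹ * (τ.comp j : Representation ℂ D V) d⁻¹) * F x := by
    intro d
    symm
    refine Fintype.sum_equiv (Equiv.mulLeft (j d)) _ _ fun x => ?_
    rw [Equiv.coe_mulLeft, hF, ← hτ.map_inv, mul_inv_rev]
    simp only [Representation.character, MonoidHom.comp_apply, map_mul, map_inv]
  have h2 := Finset.sum_congr (rfl : (Finset.univ : Finset D) = _) fun d _ => h1 d
  rw [Finset.sum_const, Finset.card_univ, Finset.sum_comm, nsmul_eq_mul] at h2
  have h3 : ∀ x, ∑ d, LinearMap.trace ℂ V ((τ.comp j : Representation ℂ D V) d * τ x) *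
        LinearMap.trace ℂ V (τ x⁻¹ * (τ.comp j : Representation ℂ D V) d⁻¹) * F x =
      (Fintype.card D : ℂ) * F x := by
    intro x
    rw [← Finset.sum_mul, hirr.sum_trace_mul_trace, ← map_mul, inv_mul_cancel, map_one,
      LinearMap.trace_one, mul_assoc (Nat.card D : ℂ), mul_inv_cancel₀ hirr.finrank_ne_zero,
      mul_one, Nat.card_eq_fintype_card]
  rw [Finset.sum_congr rfl fun x _ => h3 x, ← Finset.mul_sum] at h2
  refine mul_left_cancel₀ ?_ h2
  exact_mod_cast Fintype.card_ne_zero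

omit hD in
theorem classInner_character_mul (hj : ∀ d, π (j d) = d)
    (hirr : Representation.IsIrreducible (τ.comp j : Representation ℂ D V))
    (hl : ∀ z : D.comap π, l z • τ z = τ (j ⟨π z, z.2⟩)) {η η' : A → ℂ}
    (hη : OverLin (D.comap π) l η) (hη' : OverLin (D.comap π) l η') :
    classInner (τ.character * η) (τ.character * η') = classInner η η' := by
  have hinv : ∀ {f : A → ℂ}, OverLin (D.comap π) l f → ∀ (d : D) x, f (j d * x) = f x := by
    intro f hf d x
    have hd : j d ∈ D.comap π := by
      rw [Subgroup.mem_comap, hj]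
      exact d.2
    have h := hf ⟨j d, hd⟩ x
    rwa [apply_section_eq_one hj hirr hl, one_mul] at h
  rw [classInner, classInner, ← sum_character_mul_conj_mul hirr
    (F := fun x => η x * (starRingEnd ℂ) (η' x))]
  · congr 1
    refine Finset.sum_congr rfl fun x _ => ?_
    rw [Pi.mul_apply, Pi.mul_apply, map_mul]
    ring
  · intro d x
    simp only [hinv hη, hinv hη']

omit hD in
theorem IsIrrChar.character_mul (hj : ∀ d, π (j d) = d)
    (hirr : Representation.IsIrreducible (τ.comp j : Representation ℂ D V))
    (hl : ∀ z : D.comap π, l z • τ z = τ (j ⟨π z, z.2⟩)) {η : A → ℂ} (hη : IsIrrChar A η)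
    (hη' : OverLin (D.comap π) l η) : IsIrrChar A (τ.character * η) := by
  refine ((isCharacter_character τ).mul hη.1).isIrrChar_of_classInner ?_
  rw [classInner_character_mul hj hirr hl hη' hη', hη.classInner_self]

omit hD [Fintype A] [Fintype G] [FiniteDimensional ℂ V] in
theorem apply_mul_character (hl : ∀ z : D.comap π, l z • τ z = τ (j ⟨π z, z.2⟩))
    (z : D.comap π) (x : A) :
    l z * τ.character (z * x) = LinearMap.trace ℂ V (τ (j ⟨π z, z.2⟩) * τ x) := by
  rw [← hl, smul_mul_assoc, map_smul, smul_eq_mul, ← map_mul]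
  rfl

omit hD in
theorem exists_eq_comp_character_mul (hπ : Function.Surjective π) (hj : ∀ d, π (j d) = d)
    (hirr : Representation.IsIrreducible (τ.comp j : Representation ℂ D V))
    (hl : ∀ z : D.comap π, l z • τ z = τ (j ⟨π z, z.2⟩)) {η : A → ℂ} (hη : IsIrrChar A η)
    (hη' : OverLin (D.comap π) l η) :
    ∃ f, IsIrrChar G f ∧ τ.character * η = f ∘ π := by
  refine (hη.character_mul hj hirr hl hη').exists_eq_comp hπ fun z x => ?_
  have hz : (z : A) ∈ D.comap π := by
    rw [Subgroup.mem_comap, (MonoidHom.mem_ker).1 z.2]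
    exact D.one_mem
  have h1 := hη' ⟨z, hz⟩ x
  have h2 := apply_mul_character hl ⟨z, hz⟩ x
  have h3 : (⟨π z, hz⟩ : D) = 1 := Subtype.ext z.2
  change _ = LinearMap.trace ℂ V (τ (j ⟨π z, hz⟩) * τ x) at h2
  rw [h3, map_one, map_one, one_mul] at h2
  rw [Pi.mul_apply, Pi.mul_apply, MonoidHom.one_apply, one_mul]
  change τ.character (z * x) * η (z * x) = LinearMap.trace ℂ V (τ x) * η x
  rw [← h2, h1]
  ring

end Correspondence

section TwistedSum

variable {A : Type} [Group A] [Fintype A] {B : Subgroup A} {l : B →* ℂ} {θ : A → ℂ}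

/-- The component of `θ` on which `B` acts through `l` (up to a factor). -/
def twistedSum (B : Subgroup A) (l : B →* ℂ) (θ : A → ℂ) (x : A) : ℂ :=
  ∑ z : B, (starRingEnd ℂ) (l z) * θ (z * x)

theorem overLin_twistedSum : OverLin B l (twistedSum B l θ) := by
  intro z₀ x
  rw [twistedSum, twistedSum, Finset.mul_sum]
  refine Fintype.sum_equiv (Equiv.mulRight z₀) _ _ fun z => ?_
  rw [Equiv.coe_mulRight, map_mul, map_mul, Subgroup.coe_mul, mul_assoc (z : A)]
  linear_combination -(starRingEnd ℂ) (l z) * θ (z * (z₀ * x)) * lin_mul_conj l z₀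

theorem twistedSum_conj [hB : B.Normal] (hl : InvariantLin B l)
    (hθ : ∀ x g, θ (g * x * g⁻¹) = θ x) (x g : A) :
    twistedSum B l θ (g * x * g⁻¹) = twistedSum B l θ x := by
  rw [twistedSum, twistedSum]
  symm
  refine Fintype.sum_equiv (MulAut.conjNormal g).toEquiv _ _ fun z => ?_
  have h1 : (MulAut.conjNormal g).toEquiv z =
      (⟨g * z * g⁻¹, hB.conj_mem _ z.2 g⟩ : B) := Subtype.ext (MulAut.conjNormal_apply g z)
  rw [h1, hl, ← hθ _ g]
  congr 2
  group

theorem classInner_twistedSum {ψ : A → ℂ} (hψ : OverLin B l ψ) :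
    classInner (twistedSum B l θ) ψ = Nat.card B * classInner θ ψ := by
  have h1 : ∀ z : B, ∑ x, (starRingEnd ℂ) (l z) * θ (z * x) * (starRingEnd ℂ) (ψ x) =
      ∑ x, θ x * (starRingEnd ℂ) (ψ x) := by
    intro z
    refine Fintype.sum_equiv (Equiv.mulLeft (z : A)) _ _ fun x => ?_
    rw [Equiv.coe_mulLeft, hψ, map_mul]
    ring
  rw [classInner, classInner]
  simp only [twistedSum, Finset.sum_mul]
  rw [Finset.sum_comm, Finset.sum_congr rfl fun z _ => h1 z, Finset.sum_const, Finset.card_univ,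
    nsmul_eq_mul, Nat.card_eq_fintype_card (α := B)]
  ring

end TwistedSum

section Correspondence

variable {A G : Type} [Group A] [Fintype A] [Group G] [Fintype G] {D : Subgroup G}
  {V : Type} [AddCommGroup V] [Module ℂ V] [FiniteDimensional ℂ V]
  {τ : Representation ℂ A V} {π : A →* G} {j : D →* A} {l : D.comap π →* ℂ}

omit [FiniteDimensional ℂ V] in
theorem twistedSum_conj_character_one (hπ : Function.Surjective π)
    (hl : ∀ z : D.comap π, l z • τ z = τ (j ⟨π z, z.2⟩)) (ξ : G → ℂ) :
    twistedSum (D.comap π) l (fun x => (starRingEnd ℂ) (τ.character x) * ξ (π x)) 1 =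
      Nat.card (D.comap π) *
        classInner (resChar D ξ) (Representation.character (τ.comp j : Representation ℂ D V)) := by
  let π' : D.comap π →* D := (π.comp (D.comap π).subtype).codRestrict D fun z => z.2
  have hπ' : Function.Surjective π' := by
    intro d
    obtain ⟨a, ha⟩ := hπ d
    exact ⟨⟨a, by rw [Subgroup.mem_comap, ha]; exact d.2⟩, Subtype.ext ha⟩
  rw [← classInner_comp_of_surjective hπ', classInner, ← mul_assoc,
    mul_inv_cancel₀ card_ne_zero_complex, one_mul, twistedSum]
  refine Finset.sum_congr rfl fun z _ => ?_
  have h := apply_mul_character hl z 1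
  rw [map_one, mul_one, mul_one] at h
  have h' : Representation.character (τ.comp j : Representation ℂ D V) (π' z) =
      l z * τ.character z := h.symm
  rw [Function.comp_apply, Function.comp_apply, h', map_mul (starRingEnd ℂ), mul_one]
  change _ = ξ (π z) * _
  ring

/-- Multiplication by the character of `τ` relates the irreducible characters over `l` with the
irreducible characters of `G` over the restriction of `τ` to `D`. -/
theorem exists_bijOn_character_mul [D.Normal] {p : ℕ} (hπ : Function.Surjective π)
    (hj : ∀ d, π (j d) = d)
    (hirr : Representation.IsIrreducible (τ.comp j : Representation ℂ D V))
    (hinv : InvariantLin (D.comap π) l)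
    (hl : ∀ z : D.comap π, l z • τ z = τ (j ⟨π z, z.2⟩)) {μ : D → ℂ}
    (hμ : μ = Representation.character (τ.comp j : Representation ℂ D V)) :
    ∃ f : (A → ℂ) → (G → ℂ), Set.BijOn f (relDefZero p (D.comap π) l)
      {ξ : G → ℂ | IsIrrChar G ξ ∧ IsConstituent μ (resChar D ξ) ∧
        ∃ e : ℕ, ξ 1 = (e : ℂ) * μ 1 ∧ pPart p e = pPart p D.index} := by
  have hμi : IsIrrChar D μ := hμ ▸ hirr.isIrrChar
  have hτμ : ∀ d, τ.character (j d) = μ d := fun d => by rw [hμ]; rfl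
  have hindex : (D.comap π).index = D.index := Subgroup.index_comap_of_surjective D hπ
  have hres : ∀ {ξ : G → ℂ}, IsIrrChar G ξ → IsCharacter D (resChar D ξ) :=
    fun h => h.1.comp D.subtype
  have hsec : ∀ {η : A → ℂ} {f : G → ℂ}, τ.character * η = f ∘ π →
      (τ.character * η) ∘ Function.surjInv hπ = f := by
    intro η f h
    rw [h]
    ext g
    exact congrArg f (Function.surjInv_eq hπ g)
  refine ⟨fun η => (τ.character * η) ∘ Function.surjInv hπ, ?_, ?_, ?_⟩
  · rintro η ⟨h1, h2, n, h3, h4⟩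
    obtain ⟨f, hf, hfη⟩ := exists_eq_comp_character_mul hπ hj hirr hl h1 h2
    simp only [hsec hfη]
    have hval : ∀ d : D, f d = n * μ d := by
      intro d
      have hd : j d ∈ D.comap π := by
        rw [Subgroup.mem_comap, hj]
        exact d.2
      have h5 := congrFun hfη (j d)
      have h6 := h2 ⟨j d, hd⟩ 1
      rw [apply_section_eq_one hj hirr hl, mul_one, one_mul, h3] at h6
      change η (j d) = n at h6
      rw [Pi.mul_apply, Function.comp_apply, hj, h6, hτμ] at h5
      rw [← h5, mul_comm]
    refine ⟨hf, ?_, n, ?_, h4.trans (by rw [hindex])⟩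
    · rw [isConstituent_iff hμi (hres hf)]
      have h5 : resChar D f = (n : ℂ) • μ := funext hval
      rw [h5, classInner_smul_left, hμi.classInner_self, mul_one, ← h3]
      exact h1.1.degree_ne_zero h1.2.1
    · exact hval 1
  · rintro η ⟨h1, h2, -⟩ η' ⟨h1', h2', -⟩ heq
    obtain ⟨f, hf, hfη⟩ := exists_eq_comp_character_mul hπ hj hirr hl h1 h2
    obtain ⟨f', hf', hfη'⟩ := exists_eq_comp_character_mul hπ hj hirr hl h1' h2'
    simp only [hsec hfη, hsec hfη'] at heq
    refine h1.eq_of_classInner_ne_zero h1' ?_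
    rw [← classInner_character_mul hj hirr hl h2 h2', hfη, hfη', heq,
      classInner_comp_of_surjective hπ, hf'.classInner_self]
    exact one_ne_zero
  · rintro ξ ⟨hξ, hcon, e, he, hep⟩
    rw [isConstituent_iff hμi (hres hξ)] at hcon
    set θ : A → ℂ := fun x => (starRingEnd ℂ) (τ.character x) * ξ (π x) with hθ
    have hθc : IsCharacter A θ := (isCharacter_character τ).conj.mul (hξ.1.comp π)
    have hne : twistedSum (D.comap π) l θ ≠ 0 := by
      intro h
      have h1 := congrFun h 1
      rw [hθ, twistedSum_conj_character_one hπ hl, ← hμ] at h1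
      exact mul_ne_zero card_ne_zero_complex hcon h1
    obtain ⟨ψ, hψ, hψ0⟩ := exists_isIrrChar_classInner_ne_zero
      (twistedSum_conj hinv hθc.map_conj) hne
    have hψl := hψ.overLin_of_classInner_ne_zero hinv overLin_twistedSum hψ0
    rw [classInner_twistedSum hψl] at hψ0
    have h1 : classInner (ξ ∘ π) (τ.character * ψ) = classInner θ ψ := by
      rw [classInner, classInner]
      congr 1
      refine Finset.sum_congr rfl fun x _ => ?_
      rw [hθ, Pi.mul_apply, map_mul, Function.comp_apply]
      ring
    have h2 : ξ ∘ π = τ.character * ψ :=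
      (hξ.comp_of_surjective hπ).eq_of_classInner_ne_zero (hψ.character_mul hj hirr hl hψl)
        (h1 ▸ right_ne_zero_of_mul hψ0)
    obtain ⟨n, hn⟩ := hψ.1.exists_degree
    refine ⟨ψ, ⟨hψ, hψl, n, hn, ?_⟩, hsec h2.symm⟩
    have h3 := congrFun h2 1
    have h4 := hτμ 1
    rw [map_one] at h4
    rw [Function.comp_apply, map_one, Pi.mul_apply, he, h4, hn, mul_comm] at h3
    have h5 : e = n := by
      exact_mod_cast mul_left_cancel₀ (hμi.1.degree_ne_zero hμi.2.1) h3
    rw [hindex, ← hep, h5]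

end Correspondence

section Cover

variable {G : Type} [Group G] {D : Subgroup G} [hD : D.Normal] {V : Type} [AddCommGroup V]
  [Module ℂ V] {ρ : Representation ℂ D V}

/-- The pairs of an element `g` of `G` and an operator that intertwines `ρ` with its conjugate by
`g` and whose determinant is a root of unity of order dividing `|D|`. -/
def intertwinerCover (ρ : Representation ℂ D V) : Subgroup (G × (Module.End ℂ V)ˣ) where
  carrier := {x | (∀ d, (x.2 : Module.End ℂ V) * ρ d = ρ (MulAut.conjNormal x.1 d) * x.2) ∧
    LinearMap.det (x.2 : Module.End ℂ V) ^ Nat.card D = 1}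
  one_mem' := ⟨fun d => by simp, by simp⟩
  mul_mem' := by
    rintro x y ⟨hx, hx'⟩ ⟨hy, hy'⟩
    refine ⟨fun d => ?_, ?_⟩
    · rw [Prod.snd_mul, Prod.fst_mul, Units.val_mul, mul_assoc, hy, ← mul_assoc, hx, map_mul,
        MulAut.mul_apply, mul_assoc]
    · rw [Prod.snd_mul, Units.val_mul, map_mul, mul_pow, hx', hy', one_mul]
  inv_mem' := by
    rintro x ⟨hx, hx'⟩
    refine ⟨fun d => ?_, ?_⟩
    · have h := hx (MulAut.conjNormal x.1⁻¹ d)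
      rw [← MulAut.mul_apply, ← map_mul, mul_inv_cancel, map_one, MulAut.one_apply] at h
      rw [Prod.snd_inv, Prod.fst_inv, Units.inv_mul_eq_iff_eq_mul, ← mul_assoc, h, mul_assoc,
        Units.mul_inv, mul_one]
    · have h : LinearMap.det ((x.2⁻¹ : (Module.End ℂ V)ˣ) : Module.End ℂ V) *
          LinearMap.det (x.2 : Module.End ℂ V) = 1 := by
        rw [← map_mul, Units.inv_mul, map_one]
      rw [Prod.snd_inv, ← mul_one (_ ^ _), ← hx', ← mul_pow, h, one_pow, hx']

/-- The projection of `intertwinerCover ρ` onto `G`. -/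
def intertwinerCover.proj (ρ : Representation ℂ D V) : intertwinerCover ρ →* G :=
  (MonoidHom.fst _ _).comp (intertwinerCover ρ).subtype

/-- The tautological representation of `intertwinerCover ρ`. -/
def intertwinerCover.rep (ρ : Representation ℂ D V) : Representation ℂ (intertwinerCover ρ) V :=
  (Units.coeHom _).comp ((MonoidHom.snd _ _).comp (intertwinerCover ρ).subtype)

/-- The embedding of `D` into `intertwinerCover ρ`. -/
def intertwinerCover.incl (ρ : Representation ℂ D V) : D →* intertwinerCover ρ :=
  (D.subtype.prod (MonoidHom.toHomUnits ρ)).codRestrict _ fun d => by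
    refine ⟨fun e => ?_, ?_⟩
    · change ρ d * ρ e = ρ _ * ρ d
      rw [← map_mul, ← map_mul]
      congr 1
      ext
      simp
    · change LinearMap.det (ρ d) ^ Nat.card D = 1
      rw [← map_pow, ← map_pow, pow_card_eq_one', map_one, map_one]

theorem intertwinerCover.apply_inj {x y : intertwinerCover ρ}
    (h : intertwinerCover.proj ρ x = intertwinerCover.proj ρ y)
    (h' : intertwinerCover.rep ρ x = intertwinerCover.rep ρ y) : x = y :=
  Subtype.ext (Prod.ext h (Units.ext h'))

variable [FiniteDimensional ℂ V] [Fintype G]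

omit [Fintype G] in
theorem intertwinerCover.exists_smul_one (hρ : ρ.IsIrreducible) {x : intertwinerCover ρ}
    (hx : intertwinerCover.proj ρ x = 1) :
    ∃ c : ℂ, c ^ (Module.finrank ℂ V * Nat.card D) = 1 ∧ intertwinerCover.rep ρ x = c • 1 := by
  have hx1 : x.1.1 = 1 := hx
  have hcomm : ∀ d, intertwinerCover.rep ρ x * ρ d = ρ d * intertwinerCover.rep ρ x := by
    intro d
    have h := x.2.1 d
    rw [hx1, map_one, MulAut.one_apply] at h
    exact h
  obtain ⟨c, hc⟩ := hρ.exists_smul_one _ hcomm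
  refine ⟨c, ?_, hc⟩
  have h : LinearMap.det (intertwinerCover.rep ρ x) ^ Nat.card D = 1 := x.2.2
  rwa [hc, LinearMap.det_smul, map_one, mul_one, ← pow_mul] at h

omit [Fintype G] in
theorem intertwinerCover.pow_eq_one (hρ : ρ.IsIrreducible) {x : intertwinerCover ρ}
    (hx : intertwinerCover.proj ρ x = 1) : x ^ (Module.finrank ℂ V * Nat.card D) = 1 := by
  obtain ⟨c, hc, hc'⟩ := intertwinerCover.exists_smul_one hρ hx
  refine intertwinerCover.apply_inj ?_ ?_
  · rw [map_pow, hx, one_pow, map_one]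
  · rw [map_pow, hc', smul_pow, hc, one_pow, one_smul, map_one]

theorem intertwinerCover.finite (hρ : ρ.IsIrreducible) : Finite (intertwinerCover ρ) := by
  rw [(intertwinerCover.proj ρ).finite_iff_finite_ker_range]
  refine ⟨?_, inferInstance⟩
  have hN : 0 < Module.finrank ℂ V * Nat.card D := by
    refine Nat.mul_pos (Nat.pos_of_ne_zero ?_) Nat.card_pos
    exact_mod_cast hρ.finrank_ne_zero
  have hfin : {c : ℂ | c ^ (Module.finrank ℂ V * Nat.card D) = 1}.Finite := by
    refine (Polynomial.nthRootsFinset (Module.finrank ℂ V * Nat.card D)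
      (1 : ℂ)).finite_toSet.subset fun c hc => ?_
    exact (Polynomial.mem_nthRootsFinset hN (1 : ℂ)).2 hc
  have hfin' := hfin.image fun c : ℂ => c • (1 : Module.End ℂ V)
  have := hfin'.to_subtype
  refine Finite.of_injective (β := (fun c : ℂ => c • (1 : Module.End ℂ V)) ''
    {c : ℂ | c ^ (Module.finrank ℂ V * Nat.card D) = 1})
    (fun x => ⟨intertwinerCover.rep ρ x, ?_⟩) ?_
  · obtain ⟨c, hc, hc'⟩ := intertwinerCover.exists_smul_one hρ x.2
    exact ⟨c, hc, hc'.symm⟩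
  · intro x y h
    exact Subtype.ext (intertwinerCover.apply_inj (Eq.trans x.2 (Eq.symm y.2))
      (congrArg Subtype.val h))

theorem intertwinerCover.proj_surjective (hρ : ρ.IsIrreducible)
    (hinv : ∀ (g : G) d, ρ.character (MulAut.conjNormal g d) = ρ.character d) :
    Function.Surjective (intertwinerCover.proj ρ) := by
  intro g
  have hn : Module.finrank ℂ V ≠ 0 := by exact_mod_cast hρ.finrank_ne_zero
  let σ : Representation ℂ D V := ρ.comp (MulAut.conjNormal g : MulAut D).toMonoidHom
  have hσ : σ.character = ρ.character := funext fun d => hinv g d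
  have h0 : classInner σ.character ρ.character ≠ 0 := by
    rw [hσ, hρ.isIrrChar.classInner_self]
    exact one_ne_zero
  rw [classInner_eq_finrank, Nat.cast_ne_zero, ← pos_iff_ne_zero, Module.finrank_pos_iff] at h0
  obtain ⟨f, hf⟩ := exists_ne (0 : ρ.IntertwiningMap σ)
  have hinj : Function.Injective f.toLinearMap :=
    (Representation.IsIrreducible.injective_or_eq_zero f).resolve_right hf
  have hdet : LinearMap.det f.toLinearMap ≠ 0 :=
    (LinearMap.isUnit_det _ ((Module.End.isUnit_iff _).2
      ⟨hinj, LinearMap.injective_iff_surjective.1 hinj⟩)).ne_zero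
  obtain ⟨c, hc⟩ := IsAlgClosed.exists_pow_nat_eq (LinearMap.det f.toLinearMap)⁻¹
    (Nat.pos_of_ne_zero hn)
  have hdet' : LinearMap.det (c • f.toLinearMap) = 1 := by
    rw [LinearMap.det_smul, hc, inv_mul_cancel₀ hdet]
  have hunit : IsUnit (c • f.toLinearMap : Module.End ℂ V) :=
    LinearMap.isUnit_iff_isUnit_det _ |>.2 (hdet' ▸ isUnit_one)
  obtain ⟨u, hu⟩ := hunit
  refine ⟨⟨(g, u), fun d => ?_, ?_⟩, rfl⟩
  · change (u : Module.End ℂ V) * ρ d = ρ (MulAut.conjNormal g d) * u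
    rw [hu, smul_mul_assoc, mul_smul_comm]
    congr 1
    exact f.isIntertwining' d
  · change LinearMap.det (u : Module.End ℂ V) ^ _ = 1
    rw [hu, hdet', one_pow]

theorem intertwinerCover.isPGroup_comap_proj {p : ℕ} (hp : p.Prime) (hDp : IsPGroup p D)
    (hρ : ρ.IsIrreducible) : IsPGroup p (D.comap (intertwinerCover.proj ρ)) := by
  have : Fact p.Prime := ⟨hp⟩
  refine hDp.comap_of_ker_isPGroup _ fun x => ?_
  obtain ⟨r, hr⟩ := IsPGroup.iff_card.1 hDp
  have hdvd := hρ.finrank_dvd_card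
  rw [hr] at hdvd
  obtain ⟨s, -, hs⟩ := (Nat.dvd_prime_pow hp).1 hdvd
  refine ⟨s + r, Subtype.ext ?_⟩
  have h := intertwinerCover.pow_eq_one hρ x.2
  rwa [hs, hr, ← pow_add] at h

end Cover

section Main

variable {G : Type} [Group G] [Fintype G] {D : Subgroup G} [hD : D.Normal] {p : ℕ}

omit hD in
/-- A character of degree one, as a homomorphism. -/
theorem IsIrrChar.exists_monoidHom {μ : D → ℂ} (hμ : IsIrrChar D μ) (h1 : μ 1 = 1) :
    ∃ l : D →* ℂ, ∀ d, l d = μ d := by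
  obtain ⟨V, _, _, _, ρ, hρ, rfl⟩ := hμ.exists_isIrreducible
  have hV : Module.finrank ℂ V = 1 := by
    have h : LinearMap.trace ℂ V (ρ 1) = 1 := h1
    rw [map_one, LinearMap.trace_one] at h
    exact_mod_cast h
  refine ⟨(LinearMap.det : Module.End ℂ V →* ℂ).comp ρ, fun d => ?_⟩
  obtain ⟨c, hc⟩ := (LinearMap.existsUnique_eq_smul_id_of_finrank_eq_one hV (ρ d)).exists
  rw [MonoidHom.comp_apply, Representation.character, hc, LinearMap.det_smul, map_smul,
    LinearMap.det_id, LinearMap.trace_id, hV]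
  simp

theorem isConstituent_resChar_iff {l : D →* ℂ} (hl : InvariantLin D l) {μ : D → ℂ}
    (hμ : IsIrrChar D μ) (hlμ : ∀ d, l d = μ d) {ξ : G → ℂ} (hξ : IsIrrChar G ξ) :
    IsConstituent μ (resChar D ξ) ↔ OverLin D l ξ := by
  have hres : IsCharacter D (resChar D ξ) := hξ.1.comp D.subtype
  rw [isConstituent_iff hμ hres]
  constructor
  · intro h0
    obtain ⟨V, _, _, _, ρ, hρ, rfl⟩ := hξ.exists_isIrreducible
    refine Representation.overLin_of_eq_smul_one fun d =>
      hρ.eq_smul_one_of_sum_ne_zero hl (fun hE => h0 ?_) d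
    have htr := congrArg (LinearMap.trace ℂ V) hE
    rw [map_sum, map_zero] at htr
    have h : ∑ d, resChar D ρ.character d * (starRingEnd ℂ) (μ d) = 0 := by
      rw [← htr]
      refine Finset.sum_congr rfl fun d _ => ?_
      rw [map_smul, smul_eq_mul, lin_inv, hlμ, mul_comm]
      rfl
    rw [classInner, h, mul_zero]
  · intro h
    have h1 : resChar D ξ = ξ 1 • μ := by
      ext d
      have h2 := h d 1
      rw [mul_one, hlμ, mul_comm] at h2
      exact h2
    rw [h1, classInner_smul_left, hμ.classInner_self, mul_one]
    exact hξ.1.degree_ne_zero hξ.2.1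

omit [Fintype G] in
theorem not_dvd_orderOf_of_isPiElt (hp : p.Prime) {g : G} (hg : IsPiElt ({p}ᶜ) g) :
    ¬ p ∣ orderOf g := fun h => hg p hp h rfl

theorem exists_bijOn_of_linear (hp : p.Prime) (hDp : IsPGroup p D) {μ : D → ℂ}
    (hμ : IsIrrChar D μ) (hinv : InvariantUnder D μ ⊤) (h1 : μ 1 = 1) :
    ∃ f : ((G ⧸ D) → ℂ) → (G → ℂ),
      Set.BijOn f
        {χ : (G ⧸ D) → ℂ | IsIrrChar (G ⧸ D) χ ∧
          ∃ n : ℕ, χ 1 = (n : ℂ) ∧ pPart p n = pPart p (Nat.card (G ⧸ D))}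
        {ξ : G → ℂ | IsIrrChar G ξ ∧ IsConstituent μ (resChar D ξ) ∧
          ∃ e : ℕ, ξ 1 = (e : ℂ) * μ 1 ∧ pPart p e = pPart p D.index} ∧
      ∀ χ, ∀ g : G, IsPiElt ({p}ᶜ) g → f χ g = χ (QuotientGroup.mk g) := by
  obtain ⟨l, hl⟩ := hμ.exists_monoidHom h1
  have hlinv : InvariantLin D l := fun g d => by
    rw [hl, hl]
    exact hinv g (Subgroup.mem_top g) d _
  obtain ⟨m, hm, hm'⟩ := exists_pow_exponent hp hDp
  have hset : {ξ : G → ℂ | IsIrrChar G ξ ∧ IsConstituent μ (resChar D ξ) ∧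
      ∃ e : ℕ, ξ 1 = (e : ℂ) * μ 1 ∧ pPart p e = pPart p D.index} = relDefZero p D (1 * l) := by
    ext ξ
    simp only [relDefZero, Set.mem_ofPred_eq, one_mul, h1, mul_one]
    exact and_congr_right fun hξ =>
      and_congr_left fun _ => isConstituent_resChar_iff hlinv hμ hl hξ
  refine ⟨fun χ => (χ ∘ QuotientGroup.mk' D) * linExt D m l, ?_, fun χ g hg => ?_⟩
  · rw [hset]
    exact (bijOn_mul_linExt hp hm hm' hlinv InvariantLin.one).comp
      (bijOn_comp_of_surjective (QuotientGroup.mk'_surjective D) (QuotientGroup.ker_mk' D))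
  · change χ g * linExt D m l g = _
    rw [linExt_of_pow_eq_one l (hm' g (not_dvd_orderOf_of_isPiElt hp hg)), mul_one]

theorem exists_bijOn_of_invariant (hp : p.Prime) (hDp : IsPGroup p D) {μ : D → ℂ}
    (hμ : IsIrrChar D μ) (hinv : InvariantUnder D μ ⊤) :
    ∃ f : ((G ⧸ D) → ℂ) → (G → ℂ),
      Set.BijOn f
        {χ : (G ⧸ D) → ℂ | IsIrrChar (G ⧸ D) χ ∧
          ∃ n : ℕ, χ 1 = (n : ℂ) ∧ pPart p n = pPart p (Nat.card (G ⧸ D))}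
        {ξ : G → ℂ | IsIrrChar G ξ ∧ IsConstituent μ (resChar D ξ) ∧
          ∃ e : ℕ, ξ 1 = (e : ℂ) * μ 1 ∧ pPart p e = pPart p D.index} := by
  obtain ⟨V, _, _, _, ρ, hρ, rfl⟩ := hμ.exists_isIrreducible
  have := intertwinerCover.finite hρ
  have := Fintype.ofFinite (intertwinerCover ρ)
  let π := intertwinerCover.proj ρ
  have hπ : Function.Surjective π := intertwinerCover.proj_surjective hρ fun g d =>
    hinv g (Subgroup.mem_top g) d (hD.conj_mem _ d.2 g)
  have hincl : ∀ d, π (intertwinerCover.incl ρ d) = d := fun _ => rfl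
  have hcomp : ((intertwinerCover.rep ρ).comp (intertwinerCover.incl ρ) :
      Representation ℂ D V) = ρ := rfl
  have hirr : Representation.IsIrreducible ((intertwinerCover.rep ρ).comp
      (intertwinerCover.incl ρ) : Representation ℂ D V) := hρ
  obtain ⟨l, hl, hlr⟩ := exists_invariantLin_smul_eq (π := π) hirr fun x e => x.2.1 e
  obtain ⟨m, hm, hm'⟩ := exists_pow_exponent hp (intertwinerCover.isPGroup_comap_proj hp hDp hρ)
  obtain ⟨f, hf⟩ := exists_bijOn_character_mul (p := p) hπ hincl hirr hl hlr rfl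
  have hker : ((QuotientGroup.mk' D).comp π).ker = D.comap π := by
    rw [← MonoidHom.comap_ker, QuotientGroup.ker_mk']
  have h1 := bijOn_comp_of_surjective (p := p)
    (π := (QuotientGroup.mk' D).comp π) ((QuotientGroup.mk'_surjective D).comp hπ) hker
  have h2 := bijOn_mul_linExt hp hm hm' hl InvariantLin.one
  rw [one_mul] at h2
  exact ⟨_, hf.comp (h2.comp h1)⟩

end Main

/-- **Theorem (Statement 6, Navarro).** Let `G` be a finite group, `p` a prime, `D ⊴ G` a
`p`-subgroup and `μ ∈ Irr(D)` `G`-invariant.  Then there is a bijection `χ ↦ χ_μ` from the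
defect zero characters of `G/D` onto `rdz(G | μ)`; moreover if `μ` is linear then the
bijection can be chosen so that `χ^o = (χ_μ)^o`, i.e. the inflation of `χ` to `G` agrees
with `χ_μ` on all `p`-regular elements of `G`. -/
theorem rdz_bijection
    (p : ℕ) (hp : p.Prime)
    (G : Type) [Group G] [Fintype G]
    (D : Subgroup G) [hD : D.Normal] (hDp : IsPGroup p ↥D)
    (μ : ↥D → ℂ) (hμ : IsIrrChar ↥D μ) (hμinv : InvariantUnder D μ ⊤) :
    ∃ f : ((G ⧸ D) → ℂ) → (G → ℂ),
      Set.BijOn f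
        {χ : (G ⧸ D) → ℂ | IsIrrChar (G ⧸ D) χ ∧
          ∃ n : ℕ, χ 1 = (n : ℂ) ∧ pPart p n = pPart p (Nat.card (G ⧸ D))}
        {ξ : G → ℂ | IsIrrChar G ξ ∧ IsConstituent μ (resChar D ξ) ∧
          ∃ e : ℕ, ξ 1 = (e : ℂ) * μ 1 ∧ pPart p e = pPart p D.index} ∧
      (μ 1 = 1 →
        ∀ χ : (G ⧸ D) → ℂ,
          (IsIrrChar (G ⧸ D) χ ∧
            ∃ n : ℕ, χ 1 = (n : ℂ) ∧ pPart p n = pPart p (Nat.card (G ⧸ D))) →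
          ∀ g : G, IsPiElt ({p}ᶜ) g → f χ g = χ (QuotientGroup.mk g)) := by
  by_cases h1 : μ 1 = 1
  · obtain ⟨f, hf, hf'⟩ := exists_bijOn_of_linear hp hDp hμ hμinv h1
    exact ⟨f, hf, fun _ χ _ => hf' χ⟩
  · obtain ⟨f, hf⟩ := exists_bijOn_of_invariant hp hDp hμ hμinv
    exact ⟨f, hf, fun h => absurd h h1⟩
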